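/- Let K be a valued field whose value group has a least positive element 1_Γ, regarded as an L_VR-structure, elementarily equivalent to ℂ((t)). Let K₀ ⊆ K be a subfield that is relatively algebraically closed in K (every element of K algebraic over K₀ lies in K₀) and contains an element u with v(u) = 1_Γ. Then K₀ is an elementary L_VR-substructure of K. -/

import Mathlib

open FirstOrder

/-- The function symbols of the language `L_VR`: the ring language `{0, 1, +, ×}`. -/
inductive LVRFunc : ℕ → Type
  | zero : LVRFunc 0
  | one : LVRFunc 0
  | add : LVRFunc 2
  | mul : LVRFunc 2

/-- The relation symbols of the language `L_VR`: a binary divisibility relation `|`,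
a unary relation `N`, and a unary relation `P_n` for each `n ≥ 1`. -/
inductive LVRRel : ℕ → Type
  | dvd : LVRRel 2
  | N : LVRRel 1
  | pow : ℕ+ → LVRRel 1

/-- The first-order language `L_VR` of valuation rings. -/
def LVR : FirstOrder.Language where
  Functions := LVRFunc
  Relations := LVRRel

/-- Interpretation of the `L_VR` function symbols in a field. -/
def LVRfun (K : Type*) [Field K] : ∀ {n : ℕ}, LVRFunc n → (Fin n → K) → K
  | _, .zero => fun _ => 0
  | _, .one => fun _ => 1
  | _, .add => fun x => x 0 + x 1
  | _, .mul => fun x => x 0 * x 1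

/-- Interpretation of the `L_VR` relation symbols in a valued field (Mathlib's
multiplicative convention for valuations is order-reversing w.r.t. the additive
convention of the paper: `x | y` means `v_add(x) ≤ v_add(y)`, i.e. multiplicatively
`v (x 1) ≤ v (x 0)`; `N x` means `v_add(x) = 1_Γ`, where `γ₁` is the multiplicative
avatar of the least positive element of the value group; `P_n x` means `x` is an
`n`-th power). -/
def LVRrel {K : Type*} [Field K] {Γ₀ : Type*} [LinearOrderedCommGroupWithZero Γ₀]
    (v : Valuation K Γ₀) (γ₁ : Γ₀) : ∀ {n : ℕ}, LVRRel n → (Fin n → K) → Prop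
  | _, .dvd => fun x => v (x 1) ≤ v (x 0)
  | _, .N => fun x => v (x 0) = γ₁
  | _, .pow m => fun x => ∃ y : K, x 0 = y ^ (m : ℕ)

/-- A valued field, together with the (multiplicative avatar of the) least positive
element of its value group, as an `L_VR`-structure. -/
def valuedStructure {K : Type*} [Field K] {Γ₀ : Type*} [LinearOrderedCommGroupWithZero Γ₀]
    (v : Valuation K Γ₀) (γ₁ : Γ₀) : LVR.Structure K where
  funMap := LVRfun K
  RelMap := LVRrel v γ₁

/-- `γ₁` is the multiplicative avatar of the least positive element of the value
group: the greatest element of `Γ₀ ∖ {0}` that is `< 1`. -/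
def IsLeastPos {Γ₀ : Type*} [LinearOrderedCommGroupWithZero Γ₀] (γ₁ : Γ₀) : Prop :=
  γ₁ ≠ 0 ∧ γ₁ < 1 ∧ ∀ δ : Γ₀, δ ≠ 0 → δ < 1 → δ ≤ γ₁

/-- `ℂ((t))`, the field of formal Laurent series over `ℂ` with its `t`-adic
valuation, as an `L_VR`-structure. -/
noncomputable def laurentStructure : LVR.Structure (LaurentSeries ℂ) :=
  valuedStructure (Valued.v : Valuation (LaurentSeries ℂ) (WithZero (Multiplicative ℤ)))
    ((Multiplicative.ofAdd (-1 : ℤ) : Multiplicative ℤ) : WithZero (Multiplicative ℤ))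

namespace LVRModel

open Polynomial

section Bounds

variable {M : Type*} [Field M] {Γ : Type*} [LinearOrderedCommGroupWithZero Γ] (v : Valuation M Γ)

theorem map_natCast_le_one (n : ℕ) : v (n : M) ≤ 1 := by
  induction n with
  | zero => simp
  | succ n ih => rw [Nat.cast_succ]; exact v.map_add_le ih (by simp)

theorem map_eval_le_one {p : M[X]} {z : M} (hp : ∀ k, v (p.coeff k) ≤ 1) (hz : v z ≤ 1) :
    v (p.eval z) ≤ 1 := by
  rw [eval_eq_sum_range]
  refine v.map_sum_le fun k _ => ?_
  rw [map_mul, map_pow]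
  exact mul_le_one' (hp k) (pow_le_one' hz k)

theorem map_coeff_taylor_le_one {p : M[X]} {z : M} (hp : ∀ k, v (p.coeff k) ≤ 1) (hz : v z ≤ 1)
    (k : ℕ) : v ((taylor z p).coeff k) ≤ 1 := by
  rw [taylor_coeff]
  refine map_eval_le_one v (fun l => ?_) hz
  rw [hasseDeriv_coeff, map_mul]
  exact mul_le_one' (map_natCast_le_one v _) (hp _)

/-- If the constant term dominates all other terms of a polynomial expression, it determines the
value. -/
theorem map_eval_sub_coeff_zero_lt {p : M[X]} {y : M} {g : Γ} (hg : 0 < g)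
    (h : ∀ k, 1 ≤ k → v (p.coeff k) * v y ^ k < g) : v (p.eval y - p.coeff 0) < g := by
  rw [eval_eq_sum_range, Finset.sum_range_succ', pow_zero, mul_one, add_sub_cancel_right]
  refine v.map_sum_lt' hg fun k _ => ?_
  rw [map_mul, map_pow]
  exact h _ (by omega)

theorem map_pow_sub_pow_le {x y : M} (hx : v x ≤ 1) (hy : v y ≤ 1) (k : ℕ) :
    v (x ^ k - y ^ k) ≤ v (x - y) := by
  rw [← (Commute.all x y).mul_geom_sum₂, map_mul]
  refine mul_le_of_le_one_right' (v.map_sum_le fun l _ => ?_)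
  rw [map_mul, map_pow, map_pow]
  exact mul_le_one' (pow_le_one' hx _) (pow_le_one' hy _)

theorem map_eval_sub_eval_lt {p : M[X]} {x y : M} (hp : ∀ k, v (p.coeff k) < 1)
    (hx : v x ≤ 1) (hy : v y ≤ 1) (hxy : x ≠ y) : v (p.eval x - p.eval y) < v (x - y) := by
  rw [eval_eq_sum_range, eval_eq_sum_range, ← Finset.sum_sub_distrib]
  have h0 : v (x - y) ≠ 0 := v.ne_zero_iff.2 (sub_ne_zero.2 hxy)
  refine v.map_sum_lt h0 fun k _ => ?_
  rw [← mul_sub, map_mul]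
  calc v (p.coeff k) * v (x ^ k - y ^ k) ≤ v (p.coeff k) * v (x - y) := by
        gcongr; exact map_pow_sub_pow_le v hx hy k
    _ < 1 * v (x - y) := by
        gcongr
        · exact zero_lt_iff.2 h0
        · exact hp k
    _ = _ := one_mul _

end Bounds

/-- The polynomial `p` is in Hensel form: `p = e₀ + X + ∑_{i ≥ 2} eᵢ Xⁱ` with `e₀` integral and
`eᵢ` in the maximal ideal for `i ≥ 2`. -/
structure HenselForm {M Γ : Type*} [Field M] [LinearOrderedCommGroupWithZero Γ]
    (v : Valuation M Γ) (p : M[X]) : Prop where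
  coeff_zero : v (p.coeff 0) ≤ 1
  coeff_one : p.coeff 1 = 1
  coeff_lt : ∀ k, 2 ≤ k → v (p.coeff k) < 1

/-- Every monic nonconstant integral polynomial of degree `< n` has a root in the residue field. -/
def ResiduallyClosedBelow {F Γ : Type*} [Field F] [LinearOrderedCommGroupWithZero Γ]
    (v : Valuation F Γ) (n : ℕ) : Prop :=
  ∀ p : F[X], p.Monic → p.natDegree ≠ 0 → p.natDegree < n → (∀ k, v (p.coeff k) ≤ 1) →
    ∃ z, v z ≤ 1 ∧ v (p.eval z) < 1

/-- A henselian valued field of residue characteristic zero with algebraically closed residue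
field, whose value group is a `ℤ`-group with least positive element `γ`. -/
structure IsModel {M Γ : Type*} [Field M] [LinearOrderedCommGroupWithZero Γ]
    (v : Valuation M Γ) (γ : Γ) : Prop where
  map_natCast : ∀ n : ℕ, n ≠ 0 → v (n : M) = 1
  hensel : ∀ p : M[X], HenselForm v p → ∃ z, v z ≤ 1 ∧ p.eval z = 0
  residue : ∀ n, ResiduallyClosedBelow v n
  ne_zero : γ ≠ 0
  lt_one : γ < 1
  le_of_lt_one : ∀ x, v x < 1 → v x ≤ γ
  exists_pow : ∀ n, n ≠ 0 → ∀ x, x ≠ 0 → ∃ i < n, ∃ y, v x = γ ^ i * v y ^ n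

/-- The value of `x` is an `n`-th power in the value group. -/
def IsValPow {M Γ : Type*} [Field M] [LinearOrderedCommGroupWithZero Γ]
    (v : Valuation M Γ) (n : ℕ) (x : M) : Prop := ∃ y, v x = v y ^ n

section HenselForm

variable {M : Type*} [Field M] {Γ : Type*} [LinearOrderedCommGroupWithZero Γ] {v : Valuation M Γ}

/-- One Newton step for a polynomial in Hensel form. -/
theorem HenselForm.map_eval_add_lt {p : M[X]} (hp : HenselForm v p) {w a : M} (hw : v w ≤ 1)
    (hroot : p.eval w = 0) (ha : v a ≤ 1) (hwa : w ≠ a) :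
    v (p.eval a + (w - a)) < v (w - a) := by
  have h := map_eval_sub_eval_lt (p := p - X - C (p.coeff 0)) v (fun k => ?_) hw ha hwa
  · simp only [eval_sub, eval_X, eval_C, hroot] at h
    rw [← v.map_neg]
    convert h using 2
    ring
  · match k with
    | 0 => simp
    | 1 => simp [hp.coeff_one]
    | k + 2 =>
      simp only [coeff_sub, coeff_X, coeff_C]
      simpa using hp.coeff_lt (k + 2) (by omega)

theorem HenselForm.map_eval_eq {p : M[X]} (hp : HenselForm v p) {w a : M} (hw : v w ≤ 1)
    (hroot : p.eval w = 0) (ha : v a ≤ 1) : v (p.eval a) = v (w - a) := by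
  by_cases hwa : w = a
  · rw [← hwa, hroot, sub_self]
  · rw [← v.map_neg (w - a)]
    refine v.map_eq_of_sub_lt ?_
    rw [sub_neg_eq_add, v.map_neg]
    exact hp.map_eval_add_lt hw hroot ha hwa

end HenselForm

namespace IsModel

variable {M : Type*} [Field M] {Γ : Type*} [LinearOrderedCommGroupWithZero Γ] {v : Valuation M Γ}
  {γ : Γ}

theorem exists_root (hv : IsModel v γ) {p : M[X]} (hp : ∀ k, v (p.coeff k) ≤ 1) {z : M}
    (hz : v z ≤ 1) (h0 : v (p.eval z) < 1) (h1 : v (p.derivative.eval z) = 1) :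
    ∃ w, v (w - z) < 1 ∧ p.eval w = 0 := by
  set q := taylor z p with hq
  have hc0 : q.coeff 0 = p.eval z := taylor_coeff_zero ..
  have hc1 : q.coeff 1 = p.derivative.eval z := taylor_coeff_one ..
  by_cases hz0 : p.eval z = 0
  · exact ⟨z, by simp, hz0⟩
  have hne : p.derivative.eval z ≠ 0 := fun h => by simp [h] at h1
  have hform : HenselForm v (C (p.eval z * p.derivative.eval z)⁻¹ *
      q.comp (C (p.eval z) * X)) := by
    refine ⟨?_, ?_, fun k hk => ?_⟩
    · rw [coeff_C_mul, comp_C_mul_X_coeff, hc0, pow_zero, mul_one, mul_inv, mul_right_comm,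
        inv_mul_cancel₀ hz0, one_mul, map_inv₀, h1, inv_one]
    · rw [coeff_C_mul, comp_C_mul_X_coeff, hc1]
      field_simp
    · rw [coeff_C_mul, comp_C_mul_X_coeff]
      obtain ⟨l, rfl⟩ : ∃ l, k = l + 2 := ⟨k - 2, by omega⟩
      have : (p.eval z * p.derivative.eval z)⁻¹ * (q.coeff (l + 2) * p.eval z ^ (l + 2)) =
          (p.derivative.eval z)⁻¹ * q.coeff (l + 2) * p.eval z ^ l * p.eval z := by
        field_simp
        ring
      rw [this, map_mul, map_mul, map_mul, map_inv₀, h1, inv_one, one_mul, map_pow]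
      exact mul_lt_one_of_nonneg_of_lt_one_right
        (mul_le_one' (map_coeff_taylor_le_one v hp hz _) (pow_le_one' h0.le _)) zero_le h0
  obtain ⟨y, hy, hyr⟩ := hv.hensel _ hform
  refine ⟨z + p.eval z * y, ?_, ?_⟩
  · rw [add_sub_cancel_left, map_mul]
    exact mul_lt_one_of_lt_of_le h0 hy
  · rw [eval_mul, eval_C, mul_eq_zero] at hyr
    have := hyr.resolve_left (inv_ne_zero (mul_ne_zero hz0 hne))
    simpa [hq, taylor_eval, eval_comp, add_comm] using this

theorem exists_pow_eq_of_map_eq_one (hv : IsModel v γ) {n : ℕ} (hn : n ≠ 0) {s : M}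
    (hs : v s = 1) : ∃ y, s = y ^ n := by
  have hdeg : (X ^ n - C s).natDegree = n := natDegree_X_pow_sub_C
  have hco : ∀ k, v ((X ^ n - C s).coeff k) ≤ 1 := fun k => by
    rw [coeff_sub, coeff_X_pow, coeff_C]
    refine v.map_sub_le ?_ ?_ <;> split_ifs <;> simp [hs]
  obtain ⟨z, hz, hz1⟩ := hv.residue (n + 1) (X ^ n - C s) (monic_X_pow_sub_C s hn)
    (by rwa [hdeg]) (by omega) hco
  have hzn : v (z ^ n) = 1 := by
    rw [← hs]
    refine v.map_eq_of_sub_lt ?_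
    simpa [hs] using hz1
  have hz1' : v z = 1 := by
    rw [map_pow] at hzn
    rwa [← one_pow n, pow_left_inj₀ zero_le zero_le hn] at hzn
  obtain ⟨w, -, hw⟩ := hv.exists_root hco hz hz1 (by
    rw [derivative_sub, derivative_X_pow, derivative_C]
    simp [hz1', hv.map_natCast n hn])
  exact ⟨w, by simpa [sub_eq_zero, eq_comm] using hw⟩

theorem isValPow_iff (hv : IsModel v γ) {n : ℕ} (hn : n ≠ 0) {x : M} :
    IsValPow v n x ↔ ∃ y, x = y ^ n := by
  refine ⟨fun ⟨y, hy⟩ => ?_, fun ⟨y, hy⟩ => ⟨y, by rw [hy, map_pow]⟩⟩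
  by_cases hx : x = 0
  · exact ⟨0, by rw [hx, zero_pow hn]⟩
  have hy0 : v y ^ n ≠ 0 := hy ▸ v.ne_zero_iff.2 hx
  have hy1 : y ≠ 0 := fun h => by simp [h, hn] at hy0
  obtain ⟨t, ht⟩ := hv.exists_pow_eq_of_map_eq_one hn (s := x / y ^ n) (by
    rw [map_div₀, map_pow, hy, div_self hy0])
  exact ⟨t * y, by rw [mul_pow, ← ht]; field_simp⟩

end IsModel

section Center

variable {F M : Type*} [Field F] [Field M] {Γ : Type*} [LinearOrderedCommGroupWithZero Γ]
  (v : Valuation M Γ) (i : F →+* M) (x : M)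

/-- In the Taylor expansion of `q` at `a`, evaluated at `x`, the constant term dominates. -/
def GoodCenter (a : F) (q : F[X]) : Prop :=
  ∀ k, 1 ≤ k → v (i ((taylor a q).coeff k)) * v (x - i a) ^ k < v (i (q.eval a))

theorem coeff_taylor_derivative (a : F) (q : F[X]) (k : ℕ) :
    (taylor a (derivative q)).coeff k = (taylor a q).coeff (k + 1) * (k + 1) := by
  rw [← coeff_derivative, taylor_apply, taylor_apply, derivative_comp]
  simp

theorem eval₂_taylor (a : F) (q : F[X]) (y : M) :
    (((taylor a q).map i).eval y) = eval₂ i (y + i a) q := by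
  rw [eval_map, taylor_apply, eval₂_comp]
  simp

variable {v i x}

theorem GoodCenter.map_pos {a : F} {q : F[X]} (h : GoodCenter v i x a q) :
    0 < v (i (q.eval a)) :=
  zero_le.trans_lt (h 1 le_rfl)

theorem GoodCenter.map_eval₂ {a : F} {q : F[X]} (h : GoodCenter v i x a q) :
    v (eval₂ i x q) = v (i (q.eval a)) := by
  refine v.map_eq_of_sub_lt ?_
  have := map_eval_sub_coeff_zero_lt (p := (taylor a q).map i) (y := x - i a) v h.map_pos
    (fun k hk => by rw [coeff_map]; exact h k hk)
  rwa [eval₂_taylor, sub_add_cancel, coeff_map, taylor_coeff_zero] at this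

theorem GoodCenter.eval_center_eq {a b : F} {q : F[X]} (h : GoodCenter v i x a q)
    (hb : v (x - i b) ≤ v (x - i a)) : v (i (q.eval b)) = v (i (q.eval a)) := by
  refine v.map_eq_of_sub_lt ?_
  have hba : v (i b - i a) ≤ v (x - i a) := by
    have : i b - i a = (x - i a) - (x - i b) := by ring
    rw [this]
    exact v.map_sub_le le_rfl hb
  have := map_eval_sub_coeff_zero_lt (p := (taylor a q).map i) (y := i b - i a) v h.map_pos
    (fun k hk => by
      rw [coeff_map]
      refine lt_of_le_of_lt ?_ (h k hk)
      gcongr)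
  rwa [eval₂_taylor, sub_add_cancel, coeff_map, taylor_coeff_zero, eval₂_at_apply] at this

theorem GoodCenter.of_le {a b : F} {q : F[X]} (h : GoodCenter v i x a q)
    (hb : v (x - i b) ≤ v (x - i a)) : GoodCenter v i x b q := by
  intro k hk
  rw [h.eval_center_eq hb]
  have hba : v (i (b - a)) ≤ v (x - i a) := by
    have : i (b - a) = (x - i a) - (x - i b) := by rw [map_sub]; ring
    rw [this]
    exact v.map_sub_le le_rfl hb
  have htt : taylor b q = taylor (b - a) (taylor a q) := by
    rw [taylor_taylor, sub_add_cancel]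
  refine lt_of_le_of_lt (b := v (i ((taylor b q).coeff k)) * v (x - i a) ^ k) (by gcongr) ?_
  rw [htt, taylor_coeff, eval_eq_sum_range, map_sum, ← map_pow, ← map_mul, Finset.sum_mul]
  refine v.map_sum_lt' h.map_pos fun l _ => ?_
  rw [hasseDeriv_coeff]
  simp only [map_mul, map_pow, map_natCast]
  calc v (((l + k).choose k : ℕ) : M) * v (i ((taylor a q).coeff (l + k))) * v (i (b - a)) ^ l *
        v (x - i a) ^ k
      ≤ 1 * v (i ((taylor a q).coeff (l + k))) * v (x - i a) ^ l * v (x - i a) ^ k := by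
        gcongr
        exact map_natCast_le_one v _
    _ = v (i ((taylor a q).coeff (l + k))) * v (x - i a) ^ (l + k) := by
        rw [one_mul, mul_assoc, ← pow_add]
    _ < _ := h _ (by omega)

theorem exists_goodCenter (hchar : ∀ n : ℕ, n ≠ 0 → v (n : M) = 1) {d : ℕ}
    (hens : ∀ p : F[X], p.natDegree ≤ d → HenselForm (v.comap i) p →
      ∃ z, v (i z) ≤ 1 ∧ p.eval z = 0)
    (himm : ∀ a, ∃ b, v (x - i b) < v (x - i a)) {q : F[X]} (hq : q ≠ 0)
    (hd : q.natDegree ≤ d) : ∃ a, GoodCenter v i x a q := by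
  obtain ⟨n, hn⟩ : ∃ n, n = q.natDegree := ⟨_, rfl⟩
  induction n using Nat.strong_induction_on generalizing q with
  | _ n ih =>
  by_cases hn0 : n = 0
  · obtain ⟨c, rfl⟩ : ∃ c, q = C c := ⟨_, eq_C_of_natDegree_eq_zero (hn ▸ hn0)⟩
    refine ⟨0, fun k hk => ?_⟩
    rw [taylor_C, coeff_C_of_ne_zero (by omega), map_zero, map_zero, zero_mul, eval_C]
    refine v.pos_iff.2 ?_
    simpa using hq
  have hnc : ∀ k : ℕ, k ≠ 0 → v (i (k : F)) = 1 := fun k hk => by rw [map_natCast, hchar k hk]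
  have : CharZero F := charZero_of_inj_zero fun k hk => by
    by_contra h
    simpa [hk] using hnc k h
  have hq' : derivative q ≠ 0 := fun h => hn0 (hn ▸ derivative_eq_zero.1 h)
  have hlt : (derivative q).natDegree < q.natDegree := natDegree_derivative_lt (hn ▸ hn0)
  obtain ⟨a, ha⟩ := ih _ (hn ▸ hlt) hq' (by omega) rfl
  have hpos : ∀ a, 0 < v (x - i a) := fun a => by
    obtain ⟨b, hb⟩ := himm a
    exact zero_le.trans_lt hb
  have key : ∀ a, GoodCenter v i x a (derivative q) → ∀ k, 2 ≤ k →
      v (i ((taylor a q).coeff k)) * v (x - i a) ^ k <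
        v (i ((taylor a q).coeff 1)) * v (x - i a) := by
    intro a ha k hk
    obtain ⟨l, rfl⟩ : ∃ l, k = l + 1 := ⟨k - 1, by omega⟩
    have := ha l (by omega)
    rw [coeff_taylor_derivative, ← taylor_coeff_one, map_mul, map_mul] at this
    have h1 : v (i ((l : F) + 1)) = 1 := by exact_mod_cast hnc (l + 1) (by omega)
    rw [h1, mul_one] at this
    rw [pow_succ, ← mul_assoc]
    exact mul_lt_mul_of_pos_right this (hpos a)
  by_cases hcase : v (i ((taylor a q).coeff 1)) * v (x - i a) < v (i (q.eval a))
  · refine ⟨a, fun k hk => ?_⟩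
    obtain rfl | hk := hk.eq_or_lt
    · rwa [pow_one]
    · exact (key a ha k hk).trans hcase
  rw [not_lt] at hcase
  -- otherwise `q` has a root at least as close to `x` as `a`
  obtain ⟨b, hb⟩ : ∃ b, v (i b) = v (x - i a) := by
    obtain ⟨a', ha'⟩ := himm a
    refine ⟨a' - a, ?_⟩
    have : i (a' - a) = (x - i a) - (x - i a') := by rw [map_sub]; ring
    rw [this, v.map_sub_eq_of_lt_left ha']
  have hb0 : b ≠ 0 := fun h => (hpos a).ne (by rw [← hb, h, map_zero, map_zero])
  have hc1 : (taylor a q).coeff 1 ≠ 0 := fun h => by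
    have := ha.map_pos
    rw [← taylor_coeff_one, h] at this
    simp at this
  obtain ⟨r, hr, hqr⟩ : ∃ r, v (x - i r) ≤ v (x - i a) ∧ q.eval r = 0 := by
    have hvc1 : v (i ((taylor a q).coeff 1)) * v (x - i a) ≠ 0 := by
      rw [← hb, ← map_mul, ← map_mul]
      exact v.ne_zero_iff.2 ((map_ne_zero i).2 (mul_ne_zero hc1 hb0))
    obtain ⟨z, hz, hz0⟩ := hens (C ((taylor a q).coeff 1 * b)⁻¹ * (taylor a q).comp (C b * X))
      (by
        refine (natDegree_C_mul_le _ _).trans (natDegree_comp_le.trans ?_)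
        rw [natDegree_taylor, natDegree_C_mul_X _ hb0, mul_one]
        exact hd)
      (by
        refine ⟨?_, ?_, fun k hk => ?_⟩
        · rw [coeff_C_mul, comp_C_mul_X_coeff, pow_zero, mul_one, taylor_coeff_zero,
            Valuation.comap_apply, map_mul, map_inv₀, map_mul, map_mul, map_inv₀, map_mul, hb]
          exact inv_mul_le_one_of_le₀ hcase zero_le
        · rw [coeff_C_mul, comp_C_mul_X_coeff, pow_one, inv_mul_cancel₀ (mul_ne_zero hc1 hb0)]
        · rw [coeff_C_mul, comp_C_mul_X_coeff, Valuation.comap_apply]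
          simp only [map_mul, map_inv₀, map_pow, hb]
          exact (inv_mul_lt_one₀ (zero_lt_iff.2 (by simpa [hb] using hvc1))).2 (key a ha k hk))
    refine ⟨a + b * z, ?_, ?_⟩
    · have : x - i (a + b * z) = (x - i a) - i b * i z := by rw [map_add, map_mul]; ring
      rw [this]
      refine v.map_sub_le le_rfl ?_
      rw [map_mul, hb]
      exact mul_le_of_le_one_right' hz
    · rw [eval_mul, eval_C, mul_eq_zero] at hz0
      have := hz0.resolve_left (inv_ne_zero (mul_ne_zero hc1 hb0))
      simpa [taylor_eval, eval_comp, add_comm] using this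
  have hrg := ha.of_le hr
  obtain ⟨a', ha'⟩ := himm r
  have hag := hrg.of_le ha'.le
  have hval : v (i (q.eval a')) = v (i ((taylor r q).coeff 1)) * v (x - i r) := by
    have hsub : v (i a' - i r) = v (x - i r) := by
      have : i a' - i r = (x - i r) - (x - i a') := by ring
      rw [this, v.map_sub_eq_of_lt_left ha']
    rw [← hsub, ← map_mul]
    refine v.map_eq_of_sub_lt ?_
    have hpos' : 0 < v (i ((taylor r q).coeff 1)) * v (x - i r) := by
      have := hrg.map_pos
      rw [← taylor_coeff_one] at this
      exact mul_pos this (hpos r)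
    rw [map_mul, hsub]
    have := map_eval_sub_coeff_zero_lt (p := (taylor r q).map i - C (i ((taylor r q).coeff 1)) * X)
      (y := i a' - i r) v hpos' (fun k hk => ?_)
    · rw [eval_sub, eval₂_taylor, sub_add_cancel, eval₂_at_apply, eval_mul, eval_C, eval_X,
        coeff_sub, coeff_map, taylor_coeff_zero, hqr] at this
      simpa using this
    · rw [coeff_sub, coeff_map, coeff_C_mul, hsub]
      obtain rfl | hk := hk.eq_or_lt
      · simpa using hpos'
      · rw [coeff_X_of_ne_one (by omega), mul_zero, sub_zero]
        exact key r hrg k hk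
  have hlt' : v (i ((taylor a' q).coeff 1)) * v (x - i a') < v (i (q.eval a')) := by
    rw [hval, taylor_coeff_one, taylor_coeff_one, hrg.eval_center_eq ha'.le]
    exact mul_lt_mul_of_pos_left ha' hrg.map_pos
  refine ⟨a', fun k hk => ?_⟩
  obtain rfl | hk := hk.eq_or_lt
  · rwa [pow_one]
  · exact (key a' hag k hk).trans hlt'

end Center

section Gauss

variable {F M : Type*} [Field F] [Field M] {Γ : Type*} [LinearOrderedCommGroupWithZero Γ]
  {v : Valuation M Γ} {i : F →+* M} {x : M}

/-- If `x` is an integral element whose residue is far from the residue field of `F`, integral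
polynomials of small degree that do not vanish residually take unit values at `x`. -/
theorem map_eval₂_eq_one {n : ℕ} (hF : ResiduallyClosedBelow (v.comap i) n)
    (hx : ∀ s, v (i s) ≤ 1 → v (x - i s) = 1) {q : F[X]} (hn : q.natDegree < n)
    (hq : ∀ k, v (i (q.coeff k)) ≤ 1) (hu : ∃ k, v (i (q.coeff k)) = 1) :
    v (eval₂ i x q) = 1 := by
  have hx1 : v x = 1 := by simpa using hx 0 (by simp)
  obtain ⟨m, hm⟩ : ∃ m, m = q.natDegree := ⟨_, rfl⟩
  induction m using Nat.strong_induction_on generalizing q with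
  | _ m ih =>
  by_cases hm0 : m = 0
  · obtain ⟨c, rfl⟩ : ∃ c, q = C c := ⟨_, eq_C_of_natDegree_eq_zero (hm ▸ hm0)⟩
    obtain ⟨k, hk⟩ := hu
    rw [coeff_C] at hk
    split_ifs at hk
    · rwa [eval₂_C]
    · simp at hk
  by_cases hlead : v (i q.leadingCoeff) = 1
  · have hl0 : q.leadingCoeff ≠ 0 := fun h => by simp [h] at hlead
    have hq0 : q ≠ 0 := leadingCoeff_ne_zero.1 hl0
    have hdeg : (q * C q.leadingCoeff⁻¹).natDegree = q.natDegree :=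
      natDegree_mul_leadingCoeff_inv q hq0
    have hco : ∀ k, v (i ((q * C q.leadingCoeff⁻¹).coeff k)) ≤ 1 := fun k => by
      rw [coeff_mul_C, map_mul, map_mul, map_inv₀, map_inv₀, hlead, inv_one, mul_one]
      exact hq k
    have hmon := monic_mul_leadingCoeff_inv hq0
    obtain ⟨s, hs, hs0⟩ := hF _ hmon (by omega) (by omega) hco
    rw [Valuation.comap_apply] at hs hs0
    set p := q * C q.leadingCoeff⁻¹ with hp
    have hvp : v (eval₂ i x p) = v (eval₂ i x q) := by
      rw [hp, eval₂_mul, eval₂_C, map_mul, map_inv₀, map_inv₀, hlead, inv_one, mul_one]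
    rw [← hvp]
    have hdiv : p = (X - C s) * (p /ₘ (X - C s)) + C (p.eval s) := by
      have := modByMonic_add_div p (X - C s)
      rw [modByMonic_X_sub_C_eq_C_eval, add_comm] at this
      exact this.symm
    have hp1deg : (p /ₘ (X - C s)).natDegree = m - 1 := by
      rw [natDegree_divByMonic p (monic_X_sub_C s), natDegree_X_sub_C, hdeg, ← hm]
    have hp1lead : (p /ₘ (X - C s)).Monic := by
      rw [Monic, leadingCoeff_divByMonic_X_sub_C p _ s]
      · exact hmon
      · rw [degree_eq_natDegree hmon.ne_zero, hdeg, ← hm]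
        exact_mod_cast hm0
    have hp1co : ∀ k, v (i ((p /ₘ (X - C s)).coeff k)) ≤ 1 := fun k => by
      rw [coeff_divByMonic_X_sub_C, map_sum]
      refine v.map_sum_le fun l _ => ?_
      rw [map_mul, map_mul, map_pow, map_pow]
      exact mul_le_one' (pow_le_one' hs _) (hco _)
    have h1 := ih (m - 1) (by omega) (by omega) hp1co
      ⟨_, by rw [hp1lead.coeff_natDegree]; simp⟩ hp1deg.symm
    rw [hdiv, eval₂_add, eval₂_mul, eval₂_C, v.map_add_eq_of_lt_left] <;>
      rw [map_mul, h1, eval₂_sub, eval₂_X, eval₂_C, hx s hs, mul_one]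
    exact hs0
  · have hlt : v (i q.leadingCoeff) < 1 := lt_of_le_of_ne (hq _) hlead
    have hsplit := q.eraseLead_add_C_mul_X_pow
    have h1 : v (eval₂ i x q.eraseLead) = 1 := by
      refine ih _ ?_ ?_ (fun k => ?_) ?_ rfl
      · have := q.eraseLead_natDegree_le
        omega
      · have := q.eraseLead_natDegree_le
        omega
      · rw [eraseLead_coeff]
        split_ifs
        · simp
        · exact hq k
      · obtain ⟨k, hk⟩ := hu
        refine ⟨k, ?_⟩
        rw [eraseLead_coeff, if_neg, hk]
        rintro rfl
        exact hlead hk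
    rw [← hsplit, eval₂_add, v.map_add_eq_of_lt_left] <;> rw [h1]
    simpa [hx1] using hlt

/-- The value of a polynomial of small degree at a residually generic element is the maximum of
the values of its coefficients. -/
theorem map_eval₂_eq_coeff {n : ℕ} (hF : ResiduallyClosedBelow (v.comap i) n)
    (hx : ∀ s, v (i s) ≤ 1 → v (x - i s) = 1) {q : F[X]} (hn : q.natDegree < n) {l : ℕ}
    (hl : ∀ k, v (i (q.coeff k)) ≤ v (i (q.coeff l))) :
    v (eval₂ i x q) = v (i (q.coeff l)) := by
  by_cases h0 : q.coeff l = 0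
  · have : q = 0 := by
      ext k
      have := hl k
      simpa [h0] using this
    simp [this]
  have hv0 : v (i (q.coeff l)) ≠ 0 := by simpa using h0
  have := map_eval₂_eq_one (q := q * C (q.coeff l)⁻¹) hF hx
    ((natDegree_mul_C_le _ _).trans_lt hn) (fun k => ?_) ⟨l, ?_⟩
  · rw [eval₂_mul, eval₂_C, map_mul, map_inv₀, map_inv₀] at this
    exact (mul_inv_eq_one₀ hv0).1 this
  · rw [coeff_mul_C, map_mul, map_mul, map_inv₀, map_inv₀]
    exact mul_inv_le_one_of_le₀ (hl k) zero_le
  · rw [coeff_mul_C, map_mul, map_mul, map_inv₀, map_inv₀, mul_inv_cancel₀ hv0]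

theorem IsModel.exists_residual_root {γ : Γ} (hM : IsModel v γ) {p : F[X]}
    (hF : ResiduallyClosedBelow (v.comap i) p.natDegree) (hp : p.Monic) (hd : p.natDegree ≠ 0)
    (hco : ∀ k, v (i (p.coeff k)) ≤ 1)
    (hno : ∀ s, v (i s) ≤ 1 → v (i (p.eval s)) = 1) :
    ∃ w, eval₂ i w p = 0 ∧ ∀ s, v (i s) ≤ 1 → v (w - i s) = 1 := by
  have hco' : ∀ k, v ((p.map i).coeff k) ≤ 1 := fun k => by rw [coeff_map]; exact hco k
  have hdm : (p.map i).natDegree = p.natDegree := natDegree_map i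
  obtain ⟨z, hz, hz0⟩ := hM.residue (p.natDegree + 1) (p.map i) (hp.map i) (by omega) (by omega)
    hco'
  have hgen : ∀ z, v z ≤ 1 → v ((p.map i).eval z) < 1 → ∀ s, v (i s) ≤ 1 → v (z - i s) = 1 := by
    intro z hz hz0 s hs
    refine le_antisymm (v.map_sub_le hz hs) (not_lt.1 fun hlt => ?_)
    refine (hno s hs).not_lt ?_
    have h1 : i (p.eval s) = (p.map i).eval (i s) := by rw [eval_map, eval₂_at_apply]
    by_cases hzs : z = i s
    · rw [h1, ← hzs]
      exact hz0
    have h2 : v ((p.map i).eval z - (p.map i).eval (i s)) < 1 := by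
      refine lt_of_le_of_lt ?_ hlt
      rw [eval_eq_sum_range, eval_eq_sum_range, ← Finset.sum_sub_distrib]
      refine v.map_sum_le fun k _ => ?_
      rw [← mul_sub, map_mul]
      exact (mul_le_of_le_one_left' (hco' k)).trans (map_pow_sub_pow_le v hz hs k)
    rw [h1]
    have : (p.map i).eval (i s) = (p.map i).eval z - ((p.map i).eval z - (p.map i).eval (i s)) := by
      ring
    rw [this]
    exact v.map_sub_lt hz0 h2
  have hnc : ∀ k : ℕ, k ≠ 0 → v (i (k : F)) = 1 := fun k hk => by
    rw [_root_.map_natCast, hM.map_natCast k hk]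
  have hder : v ((p.map i).derivative.eval z) = 1 := by
    rw [derivative_map, eval_map]
    refine map_eval₂_eq_one hF (hgen z hz hz0) (natDegree_derivative_lt hd) (fun k => ?_)
      ⟨p.natDegree - 1, ?_⟩
    · rw [coeff_derivative, map_mul, map_mul]
      exact mul_le_one' (hco _) (by exact_mod_cast (hnc (k + 1) (by omega)).le)
    · have hs : p.natDegree - 1 + 1 = p.natDegree := by omega
      have hc : ((p.natDegree - 1 : ℕ) : F) + 1 = (p.natDegree : F) := by exact_mod_cast congrArg _ hs
      rw [coeff_derivative, hc, hs, hp.coeff_natDegree, one_mul, hnc _ hd]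
  obtain ⟨w, hwz, hw⟩ := hM.exists_root hco' hz hz0 hder
  have hw1 : v w ≤ 1 := by
    have : w = (w - z) + z := by ring
    rw [this]
    exact v.map_add_le hwz.le hz
  exact ⟨w, by rwa [eval_map] at hw, hgen w hw1 (by simp [hw])⟩

end Gauss

section IsValPow

variable {M : Type*} [Field M] {Γ : Type*} [LinearOrderedCommGroupWithZero Γ] {v : Valuation M Γ}

theorem IsValPow.congr {n : ℕ} {s t : M} (h : IsValPow v n s) (hst : v t = v s) :
    IsValPow v n t := by
  obtain ⟨y, hy⟩ := h
  exact ⟨y, hst.trans hy⟩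

theorem IsValPow.mul {n : ℕ} {s t : M} (hs : IsValPow v n s) (ht : IsValPow v n t) :
    IsValPow v n (s * t) := by
  obtain ⟨y, hy⟩ := hs
  obtain ⟨z, hz⟩ := ht
  exact ⟨y * z, by rw [map_mul, map_mul, hy, hz, mul_pow]⟩

theorem IsValPow.inv {n : ℕ} {s : M} (hs : IsValPow v n s) : IsValPow v n s⁻¹ := by
  obtain ⟨y, hy⟩ := hs
  exact ⟨y⁻¹, by rw [map_inv₀, map_inv₀, hy, inv_pow]⟩

theorem IsValPow.pow {n : ℕ} {s : M} (hs : IsValPow v n s) (k : ℕ) : IsValPow v n (s ^ k) := by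
  obtain ⟨y, hy⟩ := hs
  exact ⟨y ^ k, by rw [map_pow, map_pow, hy, pow_right_comm]⟩

theorem IsValPow.of_dvd {m n : ℕ} {s : M} (hs : IsValPow v m s) (h : n ∣ m) : IsValPow v n s := by
  obtain ⟨y, hy⟩ := hs
  obtain ⟨k, rfl⟩ := h
  exact ⟨y ^ k, by rw [map_pow, hy, mul_comm, pow_mul]⟩

theorem isValPow_mul_iff {n : ℕ} {s t : M} (ht : IsValPow v n t) (h0 : t ≠ 0) :
    IsValPow v n (s * t) ↔ IsValPow v n s :=
  ⟨fun h => by simpa [mul_assoc, h0] using h.mul ht.inv, fun h => h.mul ht⟩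

theorem isValPow_self_pow (n : ℕ) (s : M) : IsValPow v n (s ^ n) := ⟨s, map_pow ..⟩

theorem isValPow_pow_iff {m n : ℕ} (hm : m ≠ 0) {s : M} :
    IsValPow v (m * n) (s ^ m) ↔ IsValPow v n s := by
  constructor <;> rintro ⟨y, hy⟩ <;> refine ⟨y, ?_⟩
  · rw [map_pow, mul_comm, pow_mul] at hy
    exact (pow_left_inj₀ zero_le zero_le hm).1 hy
  · rw [map_pow, hy, mul_comm, pow_mul]

end IsValPow

section Correspondence

variable {M N : Type*} [Field M] [Field N] {Γ Δ : Type*} [LinearOrderedCommGroupWithZero Γ]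
  [LinearOrderedCommGroupWithZero Δ]

/-- A set of pairs whose coordinates satisfy the same conditions on values. -/
structure Corr (v : Valuation M Γ) (w : Valuation N Δ) (S : Set (M × N)) : Prop where
  le_iff : ∀ s ∈ S, ∀ t ∈ S, v s.1 ≤ v t.1 ↔ w s.2 ≤ w t.2
  isValPow_iff : ∀ n, n ≠ 0 → ∀ s ∈ S, IsValPow v n s.1 ↔ IsValPow w n s.2

theorem Corr.of_values {v : Valuation M Γ} {w : Valuation N Δ} {S T : Set (M × N)}
    (hS : Corr v w S) (h : ∀ z ∈ T, ∃ s ∈ S, v z.1 = v s.1 ∧ w z.2 = w s.2) : Corr v w T := by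
  refine ⟨fun z hz z' hz' => ?_, fun n hn z hz => ?_⟩
  · obtain ⟨s, hs, h1, h2⟩ := h z hz
    obtain ⟨t, ht, h3, h4⟩ := h z' hz'
    rw [h1, h2, h3, h4]
    exact hS.le_iff s hs t ht
  · obtain ⟨s, hs, h1, h2⟩ := h z hz
    have := hS.isValPow_iff n hn s hs
    exact ⟨fun h => (this.1 (h.congr h1.symm)).congr h2,
      fun h => (this.2 (h.congr h2.symm)).congr h1⟩

theorem Corr.symm {v : Valuation M Γ} {w : Valuation N Δ} {S : Set (M × N)} (hS : Corr v w S) :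
    Corr w v (Prod.swap ⁻¹' S) :=
  ⟨fun _ hs _ ht => (hS.le_iff _ hs _ ht).symm, fun n hn _ hs => (hS.isValPow_iff n hn _ hs).symm⟩

end Correspondence

/-- The definable sets used in saturation arguments. -/
inductive BasicSet {N Δ : Type*} [Field N] [LinearOrderedCommGroupWithZero Δ]
    (w : Valuation N Δ) : Set N → Prop
  | le (a b : N) : BasicSet w {y | w (y - a) ≤ w b}
  | ge (a b : N) : BasicSet w {y | w b ≤ w (y - a)}
  | pow (n : ℕ) (a : N) : BasicSet w {y | IsValPow w n (y * a)}

/-- Countable saturation with respect to basic sets. -/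
def IsSaturated {N Δ : Type*} [Field N] [LinearOrderedCommGroupWithZero Δ]
    (w : Valuation N Δ) : Prop :=
  ∀ S : ℕ → Set N, (∀ k, BasicSet w (S k)) → (∀ m, ∃ y, ∀ k < m, y ∈ S k) → ∃ y, ∀ k, y ∈ S k

theorem IsSaturated.exists_mem {N Δ ι : Type*} [Field N] [LinearOrderedCommGroupWithZero Δ]
    {w : Valuation N Δ} (hw : IsSaturated w) [Countable ι] {S : ι → Set N}
    (hS : ∀ k, BasicSet w (S k)) (h : ∀ t : Finset ι, ∃ y, ∀ k ∈ t, y ∈ S k) :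
    ∃ y, ∀ k, y ∈ S k := by
  classical
  rcases isEmpty_or_nonempty ι with _ | _
  · exact ⟨0, fun k => isEmptyElim k⟩
  obtain ⟨f, hf⟩ := exists_surjective_nat ι
  obtain ⟨y, hy⟩ := hw (fun k => S (f k)) (fun k => hS _) fun m => by
    obtain ⟨y, hy⟩ := h ((Finset.range m).image f)
    exact ⟨y, fun k hk => hy _ (Finset.mem_image_of_mem f (Finset.mem_range.2 hk))⟩
  exact ⟨y, hf.forall.2 hy⟩

section TwoSided

variable {F M N : Type*} [Field F] [Field M] [Field N] {Γ Δ : Type*}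
  [LinearOrderedCommGroupWithZero Γ] [LinearOrderedCommGroupWithZero Δ]

/-- The correspondence between `M` and `N` given by the two embeddings `i` and `j` of `F` cannot be
extended to further elements of `M₀`. -/
structure MaxExt (v : Valuation M Γ) (w : Valuation N Δ) (i : F →+* M) (j : F →+* N)
    (M₀ : Subfield M) : Prop where
  corr : Corr v w (Set.range fun a => (i a, j a))
  root_mem : ∀ p : F[X], p ≠ 0 → ∀ x, eval₂ i x p = 0 → x ∈ M₀
  maximal : ∀ x ∈ M₀, ∀ y, Corr v w (Set.range fun q : F[X] => (eval₂ i x q, eval₂ j y q)) →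
    x ∈ i.range

namespace MaxExt

variable {v : Valuation M Γ} {w : Valuation N Δ} {i : F →+* M} {j : F →+* N}
  {M₀ : Subfield M} (h : MaxExt v w i j M₀)

include h

theorem le_iff (a b : F) : v (i a) ≤ v (i b) ↔ w (j a) ≤ w (j b) :=
  h.corr.le_iff _ ⟨a, rfl⟩ _ ⟨b, rfl⟩

theorem lt_iff (a b : F) : v (i a) < v (i b) ↔ w (j a) < w (j b) := by
  rw [← not_le, ← not_le, h.le_iff]

theorem eq_iff (a b : F) : v (i a) = v (i b) ↔ w (j a) = w (j b) := by
  rw [le_antisymm_iff, le_antisymm_iff, h.le_iff, h.le_iff]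

theorem isValPow_iff {n : ℕ} (hn : n ≠ 0) (a : F) : IsValPow v n (i a) ↔ IsValPow w n (j a) :=
  h.corr.isValPow_iff n hn _ ⟨a, rfl⟩

theorem le_one_iff (a : F) : v (i a) ≤ 1 ↔ w (j a) ≤ 1 := by
  simpa using h.le_iff a 1

theorem lt_one_iff (a : F) : v (i a) < 1 ↔ w (j a) < 1 := by
  simpa using h.lt_iff a 1

theorem eq_one_iff (a : F) : v (i a) = 1 ↔ w (j a) = 1 := by
  simpa using h.eq_iff a 1

theorem mem_of_values {x : M} (hx : x ∈ M₀) {y : N} {S : Set (M × N)} (hS : Corr v w S)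
    (h0 : (0, 0) ∈ S)
    (hq : ∀ q : F[X], q ≠ 0 → ∃ s ∈ S, v (eval₂ i x q) = v s.1 ∧ w (eval₂ j y q) = w s.2) :
    x ∈ i.range := by
  refine h.maximal x hx y (Corr.of_values hS ?_)
  rintro _ ⟨q, rfl⟩
  by_cases hq0 : q = 0
  · exact ⟨_, h0, by simp [hq0], by simp [hq0]⟩
  · exact hq q hq0

theorem mem_of_root {p : F[X]} (hp : p ≠ 0) {x : M} {y : N} (hx : eval₂ i x p = 0)
    (hy : eval₂ j y p = 0) {S : Set (M × N)} (hS : Corr v w S) (h0 : (0, 0) ∈ S)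
    (hq : ∀ q : F[X], q ≠ 0 → q.natDegree < p.natDegree →
      ∃ s ∈ S, v (eval₂ i x q) = v s.1 ∧ w (eval₂ j y q) = w s.2) :
    x ∈ i.range := by
  have hd : p.natDegree ≠ 0 := fun hd => by
    rw [eq_C_of_natDegree_eq_zero hd, eval₂_C, map_eq_zero] at hx
    rw [eq_C_of_natDegree_eq_zero hd, hx, C_0] at hp
    exact hp rfl
  refine h.mem_of_values (h.root_mem p hp x hx) (y := y) hS h0 fun q _ => ?_
  have hxm : eval₂ i x q = eval₂ i x (q % p) := by
    conv_lhs => rw [← EuclideanDomain.div_add_mod q p, eval₂_add, eval₂_mul, hx, zero_mul, zero_add]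
  have hym : eval₂ j y q = eval₂ j y (q % p) := by
    conv_lhs => rw [← EuclideanDomain.div_add_mod q p, eval₂_add, eval₂_mul, hy, zero_mul, zero_add]
  rw [hxm, hym]
  by_cases hq0 : q % p = 0
  · exact ⟨_, h0, by simp [hq0], by simp [hq0]⟩
  · exact hq _ hq0 (natDegree_mod_lt q hd)

omit h in
theorem exists_map_coeff_le (v : Valuation M Γ) (i : F →+* M) (q : F[X]) :
    ∃ l, ∀ k, v (i (q.coeff k)) ≤ v (i (q.coeff l)) := by
  obtain ⟨l, -, hl⟩ := Finset.exists_max_image (Finset.range (q.natDegree + 1))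
    (fun k => v (i (q.coeff k))) ⟨0, by simp⟩
  refine ⟨l, fun k => ?_⟩
  by_cases hk : k ≤ q.natDegree
  · exact hl k (by simpa [Nat.lt_succ_iff] using hk)
  · rw [coeff_eq_zero_of_natDegree_lt (by omega)]
    simp

theorem residuallyClosedBelow_iff (n : ℕ) :
    ResiduallyClosedBelow (v.comap i) n ↔ ResiduallyClosedBelow (w.comap j) n := by
  simp only [ResiduallyClosedBelow, Valuation.comap_apply, h.le_one_iff, h.lt_one_iff]

theorem gauss_values {n : ℕ} (hF : ResiduallyClosedBelow (v.comap i) n) {x : M} {y : N}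
    (hx : ∀ s, v (i s) ≤ 1 → v (x - i s) = 1) (hy : ∀ s, v (i s) ≤ 1 → w (y - j s) = 1)
    {q : F[X]} (hn : q.natDegree < n) :
    ∃ s ∈ Set.range fun a => (i a, j a), v (eval₂ i x q) = v s.1 ∧ w (eval₂ j y q) = w s.2 := by
  obtain ⟨l, hl⟩ := exists_map_coeff_le v i q
  refine ⟨_, ⟨q.coeff l, rfl⟩, map_eval₂_eq_coeff hF hx hn hl,
    map_eval₂_eq_coeff ((h.residuallyClosedBelow_iff n).1 hF)
      (fun s hs => hy s ((h.le_one_iff s).2 hs)) hn fun k => (h.le_iff _ _).1 (hl k)⟩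

theorem residuallyClosedBelow {γ : Γ} {δ : Δ} (hM : IsModel v γ) (hN : IsModel w δ) (n : ℕ) :
    ResiduallyClosedBelow (v.comap i) n := by
  induction n with
  | zero => intro p _ _ h; omega
  | succ n ih =>
    intro p hp hd hn hco
    rcases Nat.lt_or_ge p.natDegree n with hn' | hn'
    · exact ih p hp hd hn' hco
    obtain rfl : p.natDegree = n := by omega
    by_contra hno
    push Not at hno
    have hno' : ∀ s, v (i s) ≤ 1 → v (i (p.eval s)) = 1 := fun s hs =>
      le_antisymm (map_eval_le_one (v.comap i) hco hs) (hno s hs)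
    obtain ⟨x, hx, hxs⟩ := hM.exists_residual_root ih hp hd hco hno'
    obtain ⟨y, hy, hys⟩ := hN.exists_residual_root ((h.residuallyClosedBelow_iff _).1 ih) hp hd
      (fun k => (h.le_one_iff _).1 (hco k))
      (fun s hs => (h.eq_one_iff _).1 (hno' s ((h.le_one_iff s).2 hs)))
    obtain ⟨s, rfl⟩ := h.mem_of_root hp.ne_zero hx hy h.corr ⟨0, by simp⟩ fun q _ hq =>
      h.gauss_values ih hxs (fun s hs => hys s ((h.le_one_iff s).1 hs)) hq
    have h0 := hxs 0 (by simp)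
    rw [map_zero, sub_zero] at h0
    simpa using hxs s h0.le

theorem center_values {x : M} {y : N} {β : F → F} (hx : ∀ a, v (x - i a) = v (i (β a)))
    (hy : ∀ a, w (y - j a) = w (j (β a))) {a : F} {q : F[X]} (hq : GoodCenter v i x a q) :
    ∃ s ∈ Set.range fun a => (i a, j a), v (eval₂ i x q) = v s.1 ∧ w (eval₂ j y q) = w s.2 := by
  refine ⟨_, ⟨q.eval a, rfl⟩, hq.map_eval₂, GoodCenter.map_eval₂ (a := a) fun k hk => ?_⟩
  have := hq k hk
  rw [hx, ← map_pow, ← map_mul, ← map_pow, ← map_mul, h.lt_iff] at this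
  rwa [hy, ← map_pow, ← map_mul, ← map_pow, ← map_mul]

theorem henselForm_iff (p : F[X]) : HenselForm (v.comap i) p ↔ HenselForm (w.comap j) p := by
  exact ⟨fun hp => ⟨(h.le_one_iff _).1 hp.coeff_zero, hp.coeff_one,
    fun k hk => (h.lt_one_iff _).1 (hp.coeff_lt k hk)⟩,
    fun hp => ⟨(h.le_one_iff _).2 hp.coeff_zero, hp.coeff_one,
    fun k hk => (h.lt_one_iff _).2 (hp.coeff_lt k hk)⟩⟩

theorem exists_root_of_henselForm {γ : Γ} {δ : Δ} (hM : IsModel v γ) (hN : IsModel w δ) (d : ℕ) :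
    ∀ p : F[X], p.natDegree ≤ d → HenselForm (v.comap i) p → ∃ z, v (i z) ≤ 1 ∧ p.eval z = 0 := by
  induction d with
  | zero =>
    intro p hd hp
    have := hp.coeff_one
    rw [coeff_eq_zero_of_natDegree_lt (by omega)] at this
    simp at this
  | succ d ih =>
    intro p hd hp
    have hp' := (h.henselForm_iff p).1 hp
    have hpi : HenselForm v (p.map i) := ⟨by simpa using hp.coeff_zero, by simp [hp.coeff_one],
      fun k hk => by simpa using hp.coeff_lt k hk⟩
    have hpj : HenselForm w (p.map j) := ⟨by simpa using hp'.coeff_zero, by simp [hp'.coeff_one],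
      fun k hk => by simpa using hp'.coeff_lt k hk⟩
    obtain ⟨x, hx1, hx⟩ := hM.hensel _ hpi
    obtain ⟨y, hy1, hy⟩ := hN.hensel _ hpj
    classical
    by_cases hmem : x ∈ i.range
    · obtain ⟨z, rfl⟩ := hmem
      rw [eval_map, eval₂_hom, map_eq_zero] at hx
      exact ⟨z, hx1, hx⟩
    have hne : p ≠ 0 := by
      rintro rfl
      simpa using hp.coeff_one
    refine absurd ?_ hmem
    let β : F → F := fun a => if v (i a) ≤ 1 then p.eval a else a
    have hβx : ∀ a, v (x - i a) = v (i (β a)) := fun a => by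
      by_cases ha : v (i a) ≤ 1
      · simp only [β, if_pos ha]
        rw [← hpi.map_eval_eq hx1 hx ha, eval_map, eval₂_hom]
      · simp only [β, if_neg ha]
        refine v.map_sub_eq_of_lt_right ?_
        exact hx1.trans_lt (not_le.1 ha)
    have hβy : ∀ a, w (y - j a) = w (j (β a)) := fun a => by
      by_cases ha : v (i a) ≤ 1
      · simp only [β, if_pos ha]
        rw [← hpj.map_eval_eq hy1 hy ((h.le_one_iff a).1 ha), eval_map, eval₂_hom]
      · simp only [β, if_neg ha]
        refine w.map_sub_eq_of_lt_right ?_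
        exact hy1.trans_lt (not_le.1 (mt (h.le_one_iff a).2 ha))
    have himm : ∀ a, ∃ b, v (x - i b) < v (x - i a) := fun a => by
      have hxa : x ≠ i a := fun h => hmem ⟨a, h.symm⟩
      by_cases ha : v (i a) ≤ 1
      · refine ⟨a - p.eval a, ?_⟩
        have := hpi.map_eval_add_lt hx1 hx ha hxa
        rw [eval_map, eval₂_hom] at this
        convert this using 2
        rw [map_sub]
        ring
      · refine ⟨0, ?_⟩
        rw [map_zero, sub_zero, hβx]
        simp only [β, if_neg ha]
        exact hx1.trans_lt (not_le.1 ha)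
    refine h.mem_of_root hne (by rwa [eval_map] at hx) (by rwa [eval_map] at hy) h.corr
      ⟨0, by simp⟩ fun q hq hqd => ?_
    obtain ⟨a, ha⟩ := exists_goodCenter hM.map_natCast
      ih himm hq (by omega)
    exact h.center_values hβx hβy ha

end MaxExt

end TwoSided

section Monomials

variable {F M N : Type*} [Field F] [Field M] [Field N] {Γ Δ : Type*}
  [LinearOrderedCommGroupWithZero Γ] [LinearOrderedCommGroupWithZero Δ]
  {v : Valuation M Γ} {w : Valuation N Δ} {i : F →+* M} {j : F →+* N}

theorem Corr.of_pow {S T : Set (M × N)} (hT : Corr v w T) {n : ℕ} (hn : n ≠ 0)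
    (h : ∀ s ∈ S, ∃ t ∈ T, v (s.1 ^ n) = v t.1 ∧ w (s.2 ^ n) = w t.2) : Corr v w S := by
  have hc : Corr v w ((fun s : M × N => (s.1 ^ n, s.2 ^ n)) '' S) := hT.of_values (by
    rintro _ ⟨s, hs, rfl⟩
    exact h s hs)
  refine ⟨fun s hs t ht => ?_, fun m hm s hs => ?_⟩
  · have := hc.le_iff _ ⟨s, hs, rfl⟩ _ ⟨t, ht, rfl⟩
    simpa only [map_pow, pow_le_pow_iff_left₀ zero_le zero_le hn] using this
  · have := hc.isValPow_iff (n * m) (by positivity) _ ⟨s, hs, rfl⟩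
    rwa [isValPow_pow_iff hn, isValPow_pow_iff hn] at this

theorem map_mul_pow_le_iff {x c d : M} (hx : x ≠ 0) {k l : ℕ} (hkl : k ≤ l) (hd : d ≠ 0) :
    v (c * x ^ k) ≤ v (d * x ^ l) ↔ v (c / d) ≤ v (x ^ (l - k)) := by
  have hd' : 0 < v d := zero_lt_iff.2 (v.ne_zero_iff.2 hd)
  have hxk : 0 < v (x ^ k) := zero_lt_iff.2 (v.ne_zero_iff.2 (pow_ne_zero _ hx))
  conv_lhs => rw [← Nat.sub_add_cancel hkl, pow_add, ← mul_assoc, map_mul, map_mul _ _ (x ^ k),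
    mul_le_mul_iff_left₀ hxk, map_mul, mul_comm]
  rw [map_div₀, div_le_iff₀ hd']

theorem le_map_mul_pow_iff {x c d : M} (hx : x ≠ 0) {k l : ℕ} (hkl : k ≤ l) (hd : d ≠ 0) :
    v (d * x ^ l) ≤ v (c * x ^ k) ↔ v (x ^ (l - k)) ≤ v (c / d) := by
  have hd' : 0 < v d := zero_lt_iff.2 (v.ne_zero_iff.2 hd)
  have hxk : 0 < v (x ^ k) := zero_lt_iff.2 (v.ne_zero_iff.2 (pow_ne_zero _ hx))
  conv_lhs => rw [← Nat.sub_add_cancel hkl, pow_add, ← mul_assoc, map_mul, map_mul _ _ (x ^ k),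
    mul_le_mul_iff_left₀ hxk, map_mul, mul_comm]
  rw [map_div₀, le_div_iff₀ hd']

/-- The monomials in `x` and `y` with coefficients in `F`. -/
def monomials (i : F →+* M) (j : F →+* N) (x : M) (y : N) : Set (M × N) :=
  Set.range fun z : F × ℕ => (i z.1 * x ^ z.2, j z.1 * y ^ z.2)

theorem exists_monomial_values {x : M} {y : N} (hS : Corr v w (monomials i j x y)) {m : ℕ}
    (hm : ∀ k, k ≠ 0 → k < m → ∀ g, v (x ^ k) ≠ v (i g)) {q : F[X]} (hq : q ≠ 0)
    (hqm : q.natDegree < m) :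
    ∃ s ∈ monomials i j x y, v (eval₂ i x q) = v s.1 ∧ w (eval₂ j y q) = w s.2 := by
  have hx : 1 < m → x ≠ 0 := fun h1 h0 => hm 1 one_ne_zero h1 0 (by simp [h0])
  have hdist : ∀ k l, k < l → l < m → q.coeff l ≠ 0 →
      v (i (q.coeff k) * x ^ k) ≠ v (i (q.coeff l) * x ^ l) := by
    intro k l hkl hlm hl h
    refine hm (l - k) (by omega) (by omega) (q.coeff k / q.coeff l) ?_
    have hx' := hx (by omega)
    have hl' : i (q.coeff l) ≠ 0 := (map_ne_zero i).2 hl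
    rw [map_div₀]
    refine le_antisymm ?_ ?_
    · exact (le_map_mul_pow_iff hx' hkl.le hl').1 h.ge
    · exact (map_mul_pow_le_iff hx' hkl.le hl').1 h.le
  obtain ⟨l, hl, hmax⟩ := Finset.exists_max_image q.support
    (fun k => v (i (q.coeff k) * x ^ k)) (nonempty_support_iff.2 hq)
  have hlt : ∀ k ∈ q.support \ {l}, v (i (q.coeff k) * x ^ k) < v (i (q.coeff l) * x ^ l) := by
    intro k hk
    rw [Finset.mem_sdiff, Finset.mem_singleton] at hk
    have hk' := le_natDegree_of_mem_supp k hk.1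
    have hl' := le_natDegree_of_mem_supp l hl
    refine lt_of_le_of_ne (hmax k hk.1) ?_
    rcases lt_or_gt_of_ne hk.2 with h | h
    · exact hdist k l h (by omega) (mem_support_iff.1 hl)
    · exact (hdist l k h (by omega) (mem_support_iff.1 hk.1)).symm
  refine ⟨_, ⟨(q.coeff l, l), rfl⟩, ?_, ?_⟩
  · rw [eval₂_eq_sum, Polynomial.sum_def]
    exact v.map_sum_eq_of_lt hl hlt
  · rw [eval₂_eq_sum, Polynomial.sum_def]
    refine w.map_sum_eq_of_lt hl fun k hk => ?_
    have := hlt k hk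
    rw [← not_le] at this ⊢
    rwa [← hS.le_iff (i (q.coeff l) * x ^ l, j (q.coeff l) * y ^ l) ⟨(q.coeff l, l), rfl⟩
      (i (q.coeff k) * x ^ k, j (q.coeff k) * y ^ k) ⟨(q.coeff k, k), rfl⟩]

end Monomials

namespace MaxExt

variable {F M N : Type*} [Field F] [Field M] [Field N] {Γ Δ : Type*}
  [LinearOrderedCommGroupWithZero Γ] [LinearOrderedCommGroupWithZero Δ]
  {v : Valuation M Γ} {w : Valuation N Δ} {i : F →+* M} {j : F →+* N} {M₀ : Subfield M}
  (h : MaxExt v w i j M₀)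

include h

/-- The value group of `F` is pure in that of `M`. -/
theorem exists_map_eq_of_pow {γ : Γ} {δ : Δ} (hM : IsModel v γ) (hN : IsModel w δ) {n : ℕ}
    (hn : n ≠ 0) {x : M} {z : F} (hz : v (x ^ n) = v (i z)) : ∃ g, v x = v (i g) := by
  induction n using Nat.strong_induction_on generalizing x z with
  | _ n ih =>
  by_contra hno
  push Not at hno
  have hz' : IsValPow v n (i z) := ⟨x, by rw [← hz, map_pow]⟩
  obtain ⟨x', hx'⟩ := (hM.isValPow_iff hn).1 hz'
  obtain ⟨y', hy'⟩ := (hN.isValPow_iff hn).1 ((h.isValPow_iff hn z).1 hz')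
  have hxx : v x = v x' := by
    rw [hx', map_pow, map_pow] at hz
    exact (pow_left_inj₀ zero_le zero_le hn).1 hz
  have hdeg : (X ^ n - C z).natDegree = n := natDegree_X_pow_sub_C
  have hS : Corr v w (monomials i j x' y') := h.corr.of_pow hn (by
    rintro _ ⟨⟨c, k⟩, rfl⟩
    refine ⟨_, ⟨c ^ n * z ^ k, rfl⟩, ?_, ?_⟩
    · simp only [map_mul, map_pow, hx', mul_pow, pow_right_comm _ n k]
    · simp only [map_mul, map_pow, hy', mul_pow, pow_right_comm _ n k])
  obtain ⟨g, hg⟩ := h.mem_of_root (p := X ^ n - C z) (monic_X_pow_sub_C z hn).ne_zero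
    (x := x') (y := y') (by simp [hx']) (by simp [hy']) hS ⟨(0, 0), by simp⟩ fun q hq hqd =>
      exists_monomial_values hS (m := n) (fun k hk0 hk g hg => by
        obtain ⟨g', hg'⟩ := ih k hk hk0 hg
        exact hno g' (hxx.trans hg')) hq (by omega)
  exact hno g (by rw [hxx, hg])

theorem corr_monomials {x : M} {y : N} (hx : x ≠ 0) (hy : y ≠ 0)
    (h1 : ∀ m g, v (x ^ m) ≤ v (i g) ↔ w (y ^ m) ≤ w (j g))
    (h2 : ∀ m g, v (i g) ≤ v (x ^ m) ↔ w (j g) ≤ w (y ^ m))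
    (h3 : ∀ n, n ≠ 0 → ∃ c, c ≠ 0 ∧ IsValPow v n (x * i c) ∧ IsValPow w n (y * j c)) :
    Corr v w (monomials i j x y) := by
  constructor
  · rintro _ ⟨⟨c, k⟩, rfl⟩ _ ⟨⟨d, l⟩, rfl⟩
    simp only
    rcases le_total k l with hkl | hkl
    · by_cases hd : d = 0
      · simp [hd, hx, hy]
      rw [map_mul_pow_le_iff hx hkl (by simpa using hd),
        map_mul_pow_le_iff hy hkl (by simpa using hd), ← map_div₀, ← map_div₀, h2]
    · by_cases hc : c = 0
      · simp [hc]
      rw [le_map_mul_pow_iff hx hkl (by simpa using hc),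
        le_map_mul_pow_iff hy hkl (by simpa using hc), ← map_div₀, ← map_div₀, h1]
  · rintro n hn _ ⟨⟨c, k⟩, rfl⟩
    simp only
    obtain ⟨e, he, hxe, hye⟩ := h3 n hn
    have hie : i e ≠ 0 := by simpa using he
    have hje : j e ≠ 0 := by simpa using he
    have hx' : i c * x ^ k = i (c / e ^ k) * (x * i e) ^ k := by
      rw [map_div₀, map_pow, mul_pow]; field_simp
    have hy' : j c * y ^ k = j (c / e ^ k) * (y * j e) ^ k := by
      rw [map_div₀, map_pow, mul_pow]; field_simp
    rw [hx', hy', isValPow_mul_iff (hxe.pow k) (pow_ne_zero _ (mul_ne_zero hx hie)),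
      isValPow_mul_iff (hye.pow k) (pow_ne_zero _ (mul_ne_zero hy hje)), h.isValPow_iff hn]

end MaxExt

namespace MaxExt

variable {F M N : Type*} [Field F] [Field M] [Field N] {Γ Δ : Type*}
  [LinearOrderedCommGroupWithZero Γ] [LinearOrderedCommGroupWithZero Δ]
  {v : Valuation M Γ} {w : Valuation N Δ} {i : F →+* M} {j : F →+* N} {M₀ : Subfield M}
  (h : MaxExt v w i j M₀)

include h

theorem map_mem (a : F) : i a ∈ M₀ :=
  h.root_mem (X - C a) (X_sub_C_ne_zero a) (i a) (by simp)

omit h in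
/-- The residue class of some natural number avoids those of finitely many given elements. -/
theorem exists_natCast_avoid {γ : Γ} (hM : IsModel v γ) (t : Finset F) :
    ∃ n : ℕ, ∀ s ∈ t, 1 ≤ v (n - i s) := by
  by_contra hno
  push Not at hno
  choose f hf hlt using hno
  obtain ⟨m, -, n, -, hmn, hfmn⟩ := Finset.exists_ne_map_eq_of_card_lt_of_maps_to
    (s := Finset.range (t.card + 1)) (t := t) (by simp) (fun n _ => hf n)
  wlog hlt' : m < n generalizing m n
  · exact this n m hmn.symm hfmn.symm (lt_of_le_of_ne (not_lt.1 hlt') hmn.symm)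
  have h1 := hM.map_natCast (n - m) (by omega)
  rw [Nat.cast_sub hlt'.le] at h1
  have h2 := v.map_sub_lt (hlt n) (hlt m)
  rw [hfmn] at h2
  simp [h1] at h2

/-- Residually transcendental extensions. -/
theorem not_residual [Countable F] {γ : Γ} {δ : Δ} (hM : IsModel v γ) (hN : IsModel w δ)
    (hw : IsSaturated w) {x : M} (hx : x ∈ M₀) (hxs : ∀ s, v (i s) ≤ 1 → v (x - i s) = 1) :
    False := by
  obtain ⟨y, hy⟩ := hw.exists_mem (ι := Option {s : F // v (i s) ≤ 1})
    (S := fun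
      | none => {y | w (y - 0) ≤ w 1}
      | some s => {y | w 1 ≤ w (y - j s)})
    (by rintro (_ | s); exacts [.le 0 1, .ge _ _])
    fun t => by
      classical
      obtain ⟨n, hn⟩ := exists_natCast_avoid (i := i) hM
        ((t.eraseNone).image Subtype.val)
      refine ⟨n, ?_⟩
      rintro (_ | s) hs
      · simpa using map_natCast_le_one w n
      · have := hn s (Finset.mem_image_of_mem _ (Finset.mem_eraseNone.2 hs))
        rw [← map_natCast i, ← map_sub, ← not_lt, h.lt_one_iff, not_lt] at this
        simpa using this
  have hy0 : w y ≤ 1 := by simpa using hy none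
  have hys : ∀ s, v (i s) ≤ 1 → w (y - j s) = 1 := fun s hs =>
    le_antisymm (w.map_sub_le hy0 ((h.le_one_iff s).1 hs)) (by simpa using hy (some ⟨s, hs⟩))
  obtain ⟨s, rfl⟩ := h.mem_of_values hx h.corr (y := y) ⟨0, by simp⟩ fun q _ =>
    h.gauss_values (h.residuallyClosedBelow hM hN _) hxs hys (Nat.lt_succ_self _)
  have h0 := hxs 0 (by simp)
  rw [map_zero, sub_zero] at h0
  simpa using hxs s h0.le

/-- Immediate extensions. -/
theorem mem_of_immediate [Countable F] {γ : Γ} {δ : Δ} (hM : IsModel v γ) (hN : IsModel w δ)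
    (hw : IsSaturated w) {x : M} (hx : x ∈ M₀) {β : F → F}
    (hβ : ∀ a, v (x - i a) = v (i (β a))) (himm : ∀ a, ∃ b, v (x - i b) < v (x - i a)) :
    x ∈ i.range := by
  obtain ⟨y, hy⟩ := hw.exists_mem (ι := F × Bool)
    (S := fun
      | (a, false) => {y | w (y - j a) ≤ w (j (β a))}
      | (a, true) => {y | w (j (β a)) ≤ w (y - j a)})
    (by rintro ⟨a, _ | _⟩; exacts [.le _ _, .ge _ _])
    fun t => by
      classical
      obtain ⟨b, hb⟩ : ∃ b, ∀ a ∈ t.image Prod.fst, v (x - i b) < v (x - i a) := by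
        rcases (t.image Prod.fst).eq_empty_or_nonempty with he | he
        · exact ⟨0, by simp [he]⟩
        obtain ⟨a, -, ha⟩ := Finset.exists_min_image _ (fun a => v (x - i a)) he
        obtain ⟨b, hb⟩ := himm a
        exact ⟨b, fun a' ha' => hb.trans_le (ha a' ha')⟩
      have hbβ : ∀ a ∈ t.image Prod.fst, w (j b - j a) = w (j (β a)) := fun a ha => by
        rw [← map_sub, ← h.eq_iff, ← hβ, map_sub, ← sub_sub_sub_cancel_left (i a) (i b) x]
        have := hb a ha
        exact v.map_sub_eq_of_lt_left this
      refine ⟨j b, ?_⟩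
      rintro ⟨a, _ | _⟩ ha
      · exact (hbβ a (Finset.mem_image_of_mem Prod.fst ha)).le
      · exact (hbβ a (Finset.mem_image_of_mem Prod.fst ha)).ge
  have hyβ : ∀ a, w (y - j a) = w (j (β a)) := fun a => le_antisymm (hy (a, false)) (hy (a, true))
  refine h.mem_of_values hx h.corr (y := y) ⟨0, by simp⟩ fun q hq => ?_
  obtain ⟨a, ha⟩ := exists_goodCenter hM.map_natCast
    (h.exists_root_of_henselForm hM hN q.natDegree) himm hq le_rfl
  exact h.center_values hβ hyβ ha

/-- Extensions that enlarge the value group. -/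
theorem not_valuational [Countable F] {γ : Γ} {δ : Δ} (hM : IsModel v γ) (hN : IsModel w δ)
    (hw : IsSaturated w) {u : F} (hu : v (i u) = γ) (hu' : w (j u) = δ) {x : M} (hx : x ∈ M₀)
    (hx1 : 1 < v x) (hxF : ∀ a, v x ≠ v (i a)) : False := by
  have hu0 : u ≠ 0 := fun h => hM.ne_zero (by rw [← hu, h]; simp)
  have hx0 : x ≠ 0 := fun h => hxF 0 (by simp [h])
  have hvu : 0 < v (i u) := zero_lt_iff.2 (by simpa using hu0)
  have hwu : 0 < w (j u) := zero_lt_iff.2 (by simpa using hu0)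
  have hvx : 0 < v x := zero_lt_iff.2 (by simpa using hx0)
  have below : ∀ b, v (i b) < v x → v (i (b / u)) < v x := fun b hb => by
    refine lt_of_le_of_ne ?_ (hxF _).symm
    have := hM.le_of_lt_one (i b / x) (by rwa [map_div₀, div_lt_one₀ hvx])
    rw [map_div₀, ← hu, div_le_iff₀ hvx] at this
    rwa [map_div₀, map_div₀, div_le_iff₀ hvu, mul_comm]
  have belowPow : ∀ b, v (i b) < v x → ∀ r : ℕ, v (i (b / u ^ r)) < v x := fun b hb r => by
    induction r with
    | zero => simpa using hb
    | succ r ih => rw [pow_succ, ← div_div]; exact below _ ih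
  have above : ∀ b, v x < v (i b) → v x < v (i (b * u)) := fun b hb => by
    refine lt_of_le_of_ne (not_lt.1 fun hlt => ?_) (hxF _)
    have := below _ hlt
    rw [mul_div_cancel_right₀ _ hu0] at this
    exact lt_asymm hb this
  have hc : ∀ n, ∃ c, c ≠ 0 ∧ (n ≠ 0 → IsValPow v n (x * i c)) := fun n => by
    by_cases hn : n = 0
    · exact ⟨1, one_ne_zero, fun h => absurd hn h⟩
    obtain ⟨r, hr, z, hz⟩ := hM.exists_pow n hn x hx0
    refine ⟨u ^ (n - r), pow_ne_zero _ hu0, fun _ => ⟨z * i u, ?_⟩⟩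
    rw [map_mul, hz, map_pow, map_pow, map_mul, mul_pow, hu, mul_right_comm, ← pow_add,
      Nat.add_sub_cancel' hr.le, mul_comm]
  choose c hc0 hc using hc
  have hcdvd : ∀ m n, m ≠ 0 → n ∣ m → IsValPow v n (i (c n / c m)) := fun m n hm hnm => by
    have hn : n ≠ 0 := fun h => hm (by simpa [h] using hnm)
    have hcm : i (c m) ≠ 0 := by simpa using hc0 m
    rw [← isValPow_mul_iff ((hc m hm).of_dvd hnm) (mul_ne_zero hx0 hcm)]
    convert hc n hn using 1
    rw [map_div₀]
    field_simp
  obtain ⟨y, hy⟩ := hw.exists_mem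
    (ι := {b : F // v (i b) < v x} ⊕ {b : F // v x < v (i b)} ⊕ {n : ℕ // n ≠ 0})
    (S := fun
      | .inl b => {y | w (j (b / u)) ≤ w (y - 0)}
      | .inr (.inl b) => {y | w (y - 0) ≤ w (j (b * u))}
      | .inr (.inr n) => {y | IsValPow w n (y * j (c n))})
    (by rintro (b | b | n); exacts [.ge _ _, .le _ _, .pow _ _])
    fun t => by
      classical
      obtain ⟨b, hb, hbmax⟩ := Finset.exists_max_image
        (insert 1 ((t.toLeft).image Subtype.val)) (fun b => v (i b)) ⟨1, by simp⟩
      have hbx : v (i b) < v x := by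
        rw [Finset.mem_insert, Finset.mem_image] at hb
        rcases hb with rfl | ⟨b', -, rfl⟩
        · simpa using hx1
        · exact b'.2
      have hb0 : b ≠ 0 := fun hb0 => by simpa [hb0] using hbmax 1 (by simp)
      let m := ∏ n ∈ t.toRight.toRight, (n : ℕ)
      have hm0 : m ≠ 0 := Finset.prod_ne_zero_iff.2 fun n _ => n.2
      obtain ⟨r, hr, z, hz⟩ := hM.exists_pow m hm0 (i (b * c m))
        (by simpa using ⟨hb0, hc0 m⟩)
      have hpow : IsValPow v m (i (b / u ^ (r + m) * c m)) := by
        refine ⟨z / i u, ?_⟩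
        have hγ := hu ▸ hM.ne_zero
        rw [div_mul_eq_mul_div, map_div₀, map_div₀, hz, map_div₀, div_pow, map_pow, map_pow, hu,
          pow_add, mul_div_mul_left _ _ (pow_ne_zero _ hM.ne_zero)]
      refine ⟨j (b / u ^ (r + m)), ?_⟩
      rintro (b' | b' | n) hn
      · rw [Set.mem_ofPred_eq, sub_zero, ← h.le_iff]
        have h1 := hbmax b' (Finset.mem_insert_of_mem
          (Finset.mem_image_of_mem Subtype.val (Finset.mem_toLeft.2 hn)))
        have h2 : v (i u) ^ (r + m) ≤ v (i u) ^ 1 :=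
          pow_le_pow_right_of_le_one' (hu.trans_lt hM.lt_one).le (by omega)
        rw [map_div₀, map_div₀, map_div₀, map_div₀, map_pow, map_pow]
        rw [pow_one] at h2
        exact div_le_div₀ zero_le h1 (pow_pos hvu _) h2
      · rw [Set.mem_ofPred_eq, sub_zero, ← h.le_iff]
        exact ((belowPow b hbx _).trans (above _ b'.2)).le
      · have hnm : (n : ℕ) ∣ m := Finset.dvd_prod_of_mem _
          (Finset.mem_toRight.2 (Finset.mem_toRight.2 hn))
        rw [Set.mem_ofPred_eq, ← map_mul, ← h.isValPow_iff n.2]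
        have := (hpow.of_dvd hnm).mul (hcdvd m n hm0 hnm)
        have hcm := hc0 m
        convert this using 1
        rw [← map_mul]
        congr 1
        field_simp
  have hyb : ∀ b, v (i b) < v x → w (j (b / u)) ≤ w y := fun b hb => by
    simpa using hy (.inl ⟨b, hb⟩)
  have hya : ∀ b, v x < v (i b) → w y ≤ w (j (b * u)) := fun b hb => by
    simpa using hy (.inr (.inl ⟨b, hb⟩))
  have hyn : ∀ n, n ≠ 0 → IsValPow w n (y * j (c n)) := fun n hn => hy (.inr (.inr ⟨n, hn⟩))
  have hwu1 : w (j u) < 1 := hu' ▸ hN.lt_one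
  have hwy : 0 < w y := by
    refine lt_of_lt_of_le ?_ (hyb 1 (by simpa using hx1))
    rw [zero_lt_iff]
    simpa using hu0
  have hpure : ∀ m, m ≠ 0 → ∀ g, v (x ^ m) ≠ v (i g) := fun m hm g hg => by
    obtain ⟨g', hg'⟩ := h.exists_map_eq_of_pow hM hN hm hg
    exact hxF g' hg'
  have hroot : ∀ m, m ≠ 0 → ∀ g, g ≠ 0 → ∃ r < m, ∃ b, b ≠ 0 ∧ v (i g) = v (i (u ^ r * b ^ m)) :=
    fun m hm g hg => by
    obtain ⟨r, hr, z, hz⟩ := hM.exists_pow m hm (i g) (by simpa using hg)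
    rw [← hu] at hz
    obtain ⟨b, hb⟩ := h.exists_map_eq_of_pow hM hN hm (x := z) (z := g / u ^ r) (by
      rw [map_div₀, map_div₀, map_pow, map_pow, map_pow, hz,
        mul_div_cancel_left₀ _ (pow_ne_zero _ hvu.ne')])
    refine ⟨r, hr, b, ?_, by rw [hz, hb]; simp⟩
    rintro rfl
    rw [hb] at hz
    simp [hm, hg] at hz
  have hlt : ∀ m, m ≠ 0 → ∀ g, v (x ^ m) < v (i g) → w (y ^ m) < w (j g) := fun m hm g hlt => by
    have hg : g ≠ 0 := by rintro rfl; simp at hlt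
    obtain ⟨r, hr, b, hb0, hgb⟩ := hroot m hm g hg
    have hwb : 0 < w (j b) := zero_lt_iff.2 (by simpa using hb0)
    rw [h.eq_iff] at hgb
    rw [(h.eq_iff _ _).2 hgb] at hlt
    rw [hgb]
    have hxb : v x < v (i b) := by
      simp only [map_mul, map_pow] at hlt
      refine lt_of_pow_lt_pow_left₀ m zero_le (hlt.trans_le ?_)
      exact mul_le_of_le_one_left' (pow_le_one' (hu.trans_lt hM.lt_one).le _)
    have hyb := hya b hxb
    rw [map_mul, map_mul] at hyb
    simp only [map_mul, map_pow]
    calc w y ^ m ≤ (w (j b) * w (j u)) ^ m := pow_le_pow_left' hyb m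
      _ = w (j u) ^ m * w (j b) ^ m := by rw [mul_pow, mul_comm]
      _ < _ := by
        refine mul_lt_mul_of_pos_right ?_ (pow_pos hwb _)
        exact pow_lt_pow_right_of_lt_one₀ hwu hwu1 hr
  have hgt : ∀ m, m ≠ 0 → ∀ g, v (i g) < v (x ^ m) → w (j g) < w (y ^ m) := fun m hm g hlt => by
    by_cases hg : g = 0
    · rw [hg, map_zero, map_zero, map_pow]
      exact pow_pos hwy _
    obtain ⟨r, hr, b, hb0, hgb⟩ := hroot m hm g hg
    have hwb : 0 < w (j b) := zero_lt_iff.2 (by simpa using hb0)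
    rw [h.eq_iff] at hgb
    rw [(h.eq_iff _ _).2 hgb] at hlt
    rw [hgb]
    have hxb : v (i b) < v x := by
      refine lt_of_le_of_ne (not_lt.1 fun hxb => lt_asymm hlt ?_) (hxF _).symm
      have := above b hxb
      simp only [map_mul, map_pow] at this ⊢
      calc v x ^ m < (v (i b) * v (i u)) ^ m := pow_lt_pow_left₀ this zero_le hm
        _ = v (i u) ^ m * v (i b) ^ m := by rw [mul_pow, mul_comm]
        _ ≤ _ := mul_le_mul_left
          (pow_le_pow_right_of_le_one' (hu.trans_lt hM.lt_one).le hr.le) _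
    have hby := hyb b hxb
    rw [map_div₀, map_div₀, div_le_iff₀ hwu] at hby
    have hby' : w (j b) < w y := hby.trans_lt (mul_lt_of_lt_one_right hwy hwu1)
    simp only [map_mul, map_pow]
    refine lt_of_le_of_lt (mul_le_of_le_one_left' (pow_le_one' hwu1.le _))
      (pow_lt_pow_left₀ hby' zero_le hm)
  have hS : Corr v w (monomials i j x y) := h.corr_monomials hx0 (by simpa using hwy.ne')
    (fun m g => by
      by_cases hm : m = 0
      · simpa [hm] using h.le_iff 1 g
      refine ⟨fun hle => (hlt m hm g (lt_of_le_of_ne hle (hpure m hm g))).le, fun hle => ?_⟩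
      exact not_lt.1 fun h' => (hgt m hm g h').not_ge hle)
    (fun m g => by
      by_cases hm : m = 0
      · simpa [hm] using h.le_iff g 1
      refine ⟨fun hle => (hgt m hm g (lt_of_le_of_ne hle (hpure m hm g).symm)).le, fun hle => ?_⟩
      exact not_lt.1 fun h' => (hlt m hm g h').not_ge hle)
    fun n hn => ⟨c n, hc0 n, hc n hn, hyn n hn⟩
  obtain ⟨g, hg⟩ := h.mem_of_values hx hS (y := y) ⟨(0, 0), by simp⟩ fun q hq =>
    exists_monomial_values hS (m := q.natDegree + 1) (fun k hk _ => hpure k hk) hq (by omega)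
  exact hxF g (by rw [hg])

theorem le_range [Countable F] {γ : Γ} {δ : Δ} (hM : IsModel v γ) (hN : IsModel w δ)
    (hw : IsSaturated w) {u : F} (hu : v (i u) = γ) (hu' : w (j u) = δ) {x : M} (hx : x ∈ M₀) :
    x ∈ i.range := by
  by_contra hmem
  have hval : ∀ a, ∃ b, v (x - i a) = v (i b) := by
    by_contra hno
    push Not at hno
    obtain ⟨a, ha⟩ := hno
    have hxa : x - i a ∈ M₀ := sub_mem hx (h.map_mem a)
    rcases lt_trichotomy (v (x - i a)) 1 with h1 | h1 | h1
    · refine h.not_valuational hM hN hw hu hu' (inv_mem hxa) ?_ fun b hb => ha b⁻¹ ?_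
      · rw [map_inv₀]
        refine (one_lt_inv₀ (zero_lt_iff.2 ?_)).2 h1
        simpa using ha 0
      · rw [map_inv₀, map_inv₀, ← hb, map_inv₀, inv_inv]
    · exact ha 1 (by simpa using h1)
    · exact h.not_valuational hM hN hw hu hu' hxa h1 ha
  choose β hβ using hval
  refine hmem (h.mem_of_immediate hM hN hw hx hβ fun a => ?_)
  by_contra hno
  push Not at hno
  have hb0 : i (β a) ≠ 0 := fun hb0 => hmem ⟨a, by
    have := hβ a
    rw [hb0, map_zero, map_eq_zero, sub_eq_zero] at this
    exact this.symm⟩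
  have hvb : 0 < v (i (β a)) := zero_lt_iff.2 (v.ne_zero_iff.2 hb0)
  refine h.not_residual hM hN hw (x := (x - i a) / i (β a))
    (div_mem (sub_mem hx (h.map_mem a)) (h.map_mem _)) fun s hs => ?_
  have h1 : v ((x - i a) / i (β a)) = 1 := by rw [map_div₀, hβ, div_self hvb.ne']
  refine le_antisymm (v.map_sub_le h1.le hs) ?_
  have := hno (a + s * β a)
  have he : x - i (a + s * β a) = ((x - i a) / i (β a) - i s) * i (β a) := by
    rw [map_add, map_mul]; field_simp; ring
  rw [he, hβ, map_mul] at this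
  exact le_of_mul_le_mul_right (by rwa [one_mul]) hvb

end MaxExt

theorem countable_subfield_closure {M : Type*} [Field M] {s : Set M} (hs : s.Countable) :
    Countable (Subfield.closure s) := by
  rw [← Cardinal.mk_le_aleph0_iff]
  exact (Subfield.cardinalMk_closure_le_max s).trans (max_le hs.le_aleph0 le_rfl)

/-- A countable set is contained in a countable relatively algebraically closed subfield. -/
theorem exists_countable_subfield {M : Type*} [Field M] {s : Set M} (hs : s.Countable) :
    ∃ M₀ : Subfield M, s ⊆ M₀ ∧ Countable M₀ ∧ ∀ x : M, IsAlgebraic M₀ x → x ∈ M₀ := by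
  have := countable_subfield_closure hs
  let L := algebraicClosure (Subfield.closure s) M
  refine ⟨L.toSubfield, fun x hx => ?_, ?_, fun x hx => ?_⟩
  · exact L.algebraMap_mem ⟨x, Subfield.subset_closure hx⟩
  · rw [← Cardinal.mk_le_aleph0_iff]
    exact (Algebra.IsAlgebraic.cardinalMk_le_max (Subfield.closure s) L).trans
      (max_le (Cardinal.mk_le_aleph0_iff.2 this) le_rfl)
  · have hx' : IsAlgebraic L x := hx
    exact mem_algebraicClosure_iff.2 (hx'.restrictScalars (Subfield.closure s))

theorem mem_of_eval₂_eq_zero {F M : Type*} [Field F] [Field M] {i : F →+* M} {M₀ : Subfield M}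
    (hM₀ : ∀ x : M, IsAlgebraic M₀ x → x ∈ M₀) (hi : ∀ a, i a ∈ M₀) {p : F[X]} (hp : p ≠ 0) {x : M}
    (hx : eval₂ i x p = 0) : x ∈ M₀ := by
  refine hM₀ x ⟨p.map (i.codRestrict M₀ hi), ?_, ?_⟩
  · exact (Polynomial.map_ne_zero_iff (RingHom.injective _)).2 hp
  · rw [aeval_def, eval₂_map]
    exact hx

section Extension

variable {M N : Type*} [Field M] [Field N] {Γ Δ : Type*}
  [LinearOrderedCommGroupWithZero Γ] [LinearOrderedCommGroupWithZero Δ]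
  {v : Valuation M Γ} {w : Valuation N Δ}

theorem Corr.mono {S T : Set (M × N)} (hT : Corr v w T) (h : S ⊆ T) : Corr v w S :=
  ⟨fun s hs t ht => hT.le_iff s (h hs) t (h ht), fun n hn s hs => hT.isValPow_iff n hn s (h hs)⟩

theorem Corr.fst_eq_zero_iff {G : Subring (M × N)} (hG : Corr v w G) {z : M × N} (hz : z ∈ G) :
    z.1 = 0 ↔ z.2 = 0 := by
  have := hG.le_iff z hz 0 G.zero_mem
  simpa using this

theorem Corr.fst_injective {G : Subring (M × N)} (hG : Corr v w G) :
    Function.Injective fun z : G => (z : M × N).1 := fun s t hst => by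
  have h1 : ((s - t : G) : M × N).1 = 0 := by simpa [sub_eq_zero] using hst
  have h2 := (hG.fst_eq_zero_iff (s - t).2).1 h1
  have : ((s - t : G) : M × N) = 0 := Prod.ext h1 h2
  exact sub_eq_zero.1 (Subtype.ext this)

/-- Quotients of elements of `G`. -/
def fractions (G : Subring (M × N)) : Subring (M × N) where
  carrier := {z | ∃ s ∈ G, ∃ t ∈ G, s.1 ≠ 0 ∧ z * s = t}
  mul_mem' := by
    rintro z z' ⟨s, hs, t, ht, h0, h⟩ ⟨s', hs', t', ht', h0', h'⟩
    exact ⟨s * s', G.mul_mem hs hs', t * t', G.mul_mem ht ht', mul_ne_zero h0 h0', by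
      rw [← h, ← h', mul_mul_mul_comm]⟩
  one_mem' := ⟨1, G.one_mem, 1, G.one_mem, one_ne_zero, one_mul _⟩
  add_mem' := by
    rintro z z' ⟨s, hs, t, ht, h0, h⟩ ⟨s', hs', t', ht', h0', h'⟩
    exact ⟨s * s', G.mul_mem hs hs', t * s' + t' * s,
      G.add_mem (G.mul_mem ht hs') (G.mul_mem ht' hs), mul_ne_zero h0 h0', by
      rw [← h, ← h']; ring⟩
  zero_mem' := ⟨1, G.one_mem, 0, G.zero_mem, one_ne_zero, zero_mul _⟩
  neg_mem' := by
    rintro z ⟨s, hs, t, ht, h0, h⟩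
    exact ⟨s, hs, -t, G.neg_mem ht, h0, by rw [← h, neg_mul]⟩

theorem Corr.fractions {G : Subring (M × N)} (hG : Corr v w G) :
    Corr v w (fractions G) := by
  have key : ∀ z ∈ LVRModel.fractions G, ∃ s ∈ G, ∃ t ∈ G,
      s.1 ≠ 0 ∧ s.2 ≠ 0 ∧ z.1 * s.1 = t.1 ∧ z.2 * s.2 = t.2 := by
    rintro z ⟨s, hs, t, ht, h0, h⟩
    exact ⟨s, hs, t, ht, h0, mt (hG.fst_eq_zero_iff hs).2 h0, congrArg Prod.fst h,
      congrArg Prod.snd h⟩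
  constructor
  · intro z hz z' hz'
    obtain ⟨s, hs, t, ht, h0, h1, h, k⟩ := key z hz
    obtain ⟨s', hs', t', ht', h0', h1', h', k'⟩ := key z' hz'
    have := hG.le_iff (t * s') (G.mul_mem ht hs') (t' * s) (G.mul_mem ht' hs)
    simp only [Prod.fst_mul, Prod.snd_mul, ← h, ← k, ← h', ← k'] at this
    rw [mul_right_comm z'.1, mul_right_comm z'.2, mul_assoc, mul_assoc, mul_assoc, mul_assoc,
      map_mul, map_mul _ z'.1, map_mul _ z.2, map_mul _ z'.2,
      mul_le_mul_iff_left₀, mul_le_mul_iff_left₀] at this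
    · exact this
    · exact zero_lt_iff.2 (w.ne_zero_iff.2 (mul_ne_zero h1 h1'))
    · exact zero_lt_iff.2 (v.ne_zero_iff.2 (mul_ne_zero h0 h0'))
  · intro n hn z hz
    obtain ⟨s, hs, t, ht, h0, h1, h, k⟩ := key z hz
    have := hG.isValPow_iff n hn (t * s ^ (n - 1)) (G.mul_mem ht (pow_mem hs _))
    simp only [Prod.fst_mul, Prod.snd_mul, ← h, ← k, Prod.pow_fst, Prod.pow_snd] at this
    rwa [mul_assoc, mul_assoc, mul_pow_sub_one hn, mul_pow_sub_one hn,
      isValPow_mul_iff (isValPow_self_pow ..) (pow_ne_zero _ h0),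
      isValPow_mul_iff (isValPow_self_pow ..) (pow_ne_zero _ h1)] at this

theorem exists_maximal_corr {G₀ : Subring (M × N)} (hG₀ : Corr v w G₀) {M₀ : Subfield M}
    (hM₀ : ∀ z ∈ G₀, z.1 ∈ M₀) : ∃ G, G₀ ≤ G ∧
      Maximal (· ∈ {G : Subring (M × N) | Corr v w G ∧ ∀ z ∈ G, z.1 ∈ M₀}) G := by
  refine zorn_le_nonempty₀ _ (fun C hC hchain G hG => ?_) G₀ ⟨hG₀, hM₀⟩
  have hmem : ∀ z, z ∈ sSup C ↔ ∃ H ∈ C, z ∈ H := fun z =>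
    Subring.mem_sSup_of_directedOn ⟨G, hG⟩ hchain.directedOn
  refine ⟨sSup C, ⟨⟨fun s hs t ht => ?_, fun n hn s hs => ?_⟩, fun z hz => ?_⟩,
    fun H hH => le_sSup hH⟩
  · obtain ⟨H, hH, hs⟩ := (hmem s).1 hs
    obtain ⟨H', hH', ht⟩ := (hmem t).1 ht
    rcases hchain.total hH hH' with hle | hle
    · exact (hC hH').1.le_iff s (hle hs) t ht
    · exact (hC hH).1.le_iff s hs t (hle ht)
  · obtain ⟨H, hH, hs⟩ := (hmem s).1 hs
    exact (hC hH).1.isValPow_iff n hn s hs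
  · obtain ⟨H, hH, hz⟩ := (hmem z).1 hz
    exact (hC hH).2 z hz

/-- The extension step of the back-and-forth argument. -/
theorem exists_extension {γ : Γ} {δ : Δ} (hM : IsModel v γ) (hN : IsModel w δ)
    (hw : IsSaturated w) {G₀ : Subring (M × N)} (hG₀ : Corr v w G₀) (hc : Countable G₀)
    {u : M × N} (hu : u ∈ G₀) (hu1 : v u.1 = γ) (hu2 : w u.2 = δ) (x : M) :
    ∃ G : Subring (M × N), G₀ ≤ G ∧ Countable G ∧ Corr v w G ∧ ∃ y, (x, y) ∈ G := by
  obtain ⟨M₀, hsub, hcount, halg⟩ := exists_countable_subfield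
    (s := insert x (Prod.fst '' (G₀ : Set (M × N))))
    ((Set.Countable.image (Set.countable_coe_iff.1 hc) _).insert x)
  obtain ⟨G, hG₀G, ⟨hG, hGM⟩, hmax⟩ := exists_maximal_corr hG₀ (M₀ := M₀) fun z hz =>
    hsub (Set.mem_insert_of_mem _ ⟨z, hz, rfl⟩)
  have hGc : Countable G :=
    Function.Injective.countable (f := fun z : G => (⟨_, hGM z z.2⟩ : M₀)) fun s t hst =>
      hG.fst_injective (congrArg Subtype.val hst)
  have hinv : ∀ z ∈ G, z.1 ≠ 0 → z⁻¹ ∈ G := fun z hz h0 => by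
    have hle : fractions G ≤ G := hmax ⟨hG.fractions, by
      rintro z ⟨s, hs, t, ht, h0, h⟩
      have h' : z.1 * s.1 = t.1 := congrArg Prod.fst h
      rw [← eq_div_iff h0] at h'
      rw [h']
      exact div_mem (hGM t ht) (hGM s hs)⟩ fun z hz => ⟨1, G.one_mem, z, hz, one_ne_zero, mul_one z⟩
    refine hle ⟨z, hz, 1, G.one_mem, h0, Prod.ext ?_ ?_⟩
    · exact inv_mul_cancel₀ h0
    · exact inv_mul_cancel₀ (mt (hG.fst_eq_zero_iff hz).2 h0)
  have hfield : IsField G :=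
    { exists_pair_ne := ⟨0, 1, zero_ne_one⟩
      mul_comm := mul_comm
      mul_inv_cancel := fun {z} hz => by
        have h0 : (z : M × N).1 ≠ 0 := fun h0 => hz (hG.fst_injective (by simpa using h0))
        have h1 := mt (hG.fst_eq_zero_iff z.2).2 h0
        exact ⟨⟨_, hinv z z.2 h0⟩, Subtype.ext (Prod.ext (mul_inv_cancel₀ h0)
          (mul_inv_cancel₀ h1))⟩ }
  let _ := hfield.toField
  let i : G →+* M := (RingHom.fst M N).comp G.subtype
  let j : G →+* N := (RingHom.snd M N).comp G.subtype
  have hext : MaxExt v w i j M₀ := by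
    refine ⟨hG.mono ?_, fun p hp x hx => mem_of_eval₂_eq_zero halg (fun a => hGM _ a.2) hp hx,
      fun x hx y hxy => ?_⟩
    · rintro _ ⟨a, rfl⟩
      exact a.2
    · let f : G[X] →+* M × N := (eval₂RingHom i x).prod (eval₂RingHom j y)
      have hfM : ∀ z ∈ f.range, z.1 ∈ M₀ := by
        rintro _ ⟨q, rfl⟩
        change eval₂ i x q ∈ M₀
        rw [eval₂_eq_sum, Polynomial.sum_def]
        exact sum_mem fun k _ => mul_mem (hGM _ (q.coeff k).2) (pow_mem hx k)
      have hle : f.range ≤ G := hmax ⟨hxy.mono (by rintro _ ⟨q, rfl⟩; exact ⟨q, rfl⟩), hfM⟩ (by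
        intro z hz
        exact ⟨C ⟨z, hz⟩, Prod.ext (eval₂_C i x) (eval₂_C j y)⟩)
      exact ⟨⟨f X, hle ⟨X, rfl⟩⟩, eval₂_X i x⟩
  obtain ⟨g, hg⟩ := hext.le_range hM hN hw (u := ⟨u, hG₀G hu⟩) hu1 hu2
    (hsub (Set.mem_insert x _))
  refine ⟨G, hG₀G, hGc, hG, (g : M × N).2, ?_⟩
  rw [← hg]
  exact g.2

end Extension

section BackAndForth

open FirstOrder.Language

variable {M N : Type*} [Field M] [Field N] {Γ Δ : Type*}
  [LinearOrderedCommGroupWithZero Γ] [LinearOrderedCommGroupWithZero Δ]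
  {v : Valuation M Γ} {w : Valuation N Δ} {γ : Γ} {δ : Δ}

theorem exists_extension_symm (hM : IsModel v γ) (hN : IsModel w δ)
    (hv : IsSaturated v) {G₀ : Subring (M × N)} (hG₀ : Corr v w G₀) (hc : Countable G₀)
    {u : M × N} (hu : u ∈ G₀) (hu1 : v u.1 = γ) (hu2 : w u.2 = δ) (y : N) :
    ∃ G : Subring (M × N), G₀ ≤ G ∧ Countable G ∧ Corr v w G ∧ ∃ x, (x, y) ∈ G := by
  let e : N × M ≃+* M × N := RingEquiv.prodComm
  have hcount : ∀ {R S : Type _} [CommRing R] [CommRing S] (f : R ≃+* S) (H : Subring S),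
      Countable H → Countable (H.comap (f : R →+* S)) := fun f H hH =>
    Function.Injective.countable (f := fun z => (⟨f z.1, z.2⟩ : H)) fun a b hab =>
      Subtype.ext (f.injective (congrArg Subtype.val hab))
  obtain ⟨G, hle, hGc, hG, x, hx⟩ := exists_extension hN hM hv
    (G₀ := G₀.comap (e : N × M →+* M × N)) hG₀.symm (hcount e G₀ hc) (u := u.swap) hu hu2 hu1 y
  exact ⟨G.comap (e.symm : M × N →+* N × M), fun z hz => hle (x := z.swap) hz,
    hcount e.symm G hGc, hG.symm, x, hx⟩

theorem exists_realize_eq {G : Subring (M × N)} {α : Type*} {e : α → M × N} (he : ∀ a, e a ∈ G)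
    (t : LVR.Term α) : ∃ z ∈ G,
      @Term.realize LVR M (valuedStructure v γ) α (fun a => (e a).1) t = z.1 ∧
      @Term.realize LVR N (valuedStructure w δ) α (fun a => (e a).2) t = z.2 := by
  induction t with
  | var a => exact ⟨e a, he a, rfl, rfl⟩
  | func f ts ih =>
    choose z hz h1 h2 using ih
    have h1' := funext h1
    have h2' := funext h2
    letI := valuedStructure v γ
    letI := valuedStructure w δ
    simp only [Term.realize_func, h1', h2']
    cases f with
    | zero => exact ⟨0, G.zero_mem, rfl, rfl⟩
    | one => exact ⟨1, G.one_mem, rfl, rfl⟩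
    | add => exact ⟨z 0 + z 1, G.add_mem (hz 0) (hz 1), rfl, rfl⟩
    | mul => exact ⟨z 0 * z 1, G.mul_mem (hz 0) (hz 1), rfl, rfl⟩

theorem relMap_iff (hM : IsModel v γ) (hN : IsModel w δ) {G : Subring (M × N)} (hG : Corr v w G)
    {u : M × N} (hu : u ∈ G) (hu1 : v u.1 = γ) (hu2 : w u.2 = δ) {n : ℕ} (R : LVR.Relations n)
    {z : Fin n → M × N} (hz : ∀ k, z k ∈ G) :
    LVRrel v γ R (fun k => (z k).1) ↔ LVRrel w δ R (fun k => (z k).2) := by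
  cases R with
  | dvd => exact hG.le_iff _ (hz 1) _ (hz 0)
  | N =>
    change v (z 0).1 = γ ↔ w (z 0).2 = δ
    rw [← hu1, ← hu2, le_antisymm_iff, le_antisymm_iff, hG.le_iff _ (hz 0) _ hu,
      hG.le_iff _ hu _ (hz 0)]
  | pow m =>
    change (∃ y, (z 0).1 = y ^ (m : ℕ)) ↔ ∃ y, (z 0).2 = y ^ (m : ℕ)
    rw [← hM.isValPow_iff m.ne_zero, ← hN.isValPow_iff m.ne_zero]
    exact hG.isValPow_iff m m.ne_zero _ (hz 0)

theorem realize_iff (hM : IsModel v γ) (hN : IsModel w δ) (hv : IsSaturated v)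
    (hw : IsSaturated w) {α : Type*} {n : ℕ} (φ : LVR.BoundedFormula α n) {G : Subring (M × N)}
    (hG : Corr v w G) (hc : Countable G) {u : M × N} (hu : u ∈ G) (hu1 : v u.1 = γ)
    (hu2 : w u.2 = δ) {e : α → M × N} (he : ∀ a, e a ∈ G) {xs : Fin n → M × N}
    (hxs : ∀ k, xs k ∈ G) :
    @BoundedFormula.Realize LVR M (valuedStructure v γ) α n φ (Prod.fst ∘ e) (Prod.fst ∘ xs) ↔
    @BoundedFormula.Realize LVR N (valuedStructure w δ) α n φ (Prod.snd ∘ e) (Prod.snd ∘ xs) := by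
  letI := valuedStructure v γ
  letI := valuedStructure w δ
  have hterm : ∀ {n : ℕ} {G : Subring (M × N)} {xs : Fin n → M × N}, (∀ a, e a ∈ G) →
      (∀ k, xs k ∈ G) → ∀ t : LVR.Term (α ⊕ Fin n), ∃ z ∈ G,
      t.realize (Sum.elim (Prod.fst ∘ e) (Prod.fst ∘ xs)) = z.1 ∧
      t.realize (Sum.elim (Prod.snd ∘ e) (Prod.snd ∘ xs)) = z.2 := by
    intro n G xs he hxs t
    have := exists_realize_eq (v := v) (w := w) (γ := γ) (δ := δ) (G := G) (e := Sum.elim e xs)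
      (by rintro (a | k); exacts [he a, hxs k]) t
    rw [← Sum.comp_elim, ← Sum.comp_elim]
    exact this
  induction φ generalizing G with
  | falsum => exact Iff.rfl
  | equal t₁ t₂ =>
    obtain ⟨z₁, hz₁, h1, h2⟩ := hterm he hxs t₁
    obtain ⟨z₂, hz₂, h3, h4⟩ := hterm he hxs t₂
    simp only [BoundedFormula.Realize, h1, h2, h3, h4]
    have := hG.fst_eq_zero_iff (G.sub_mem hz₁ hz₂)
    rwa [Prod.fst_sub, Prod.snd_sub, sub_eq_zero, sub_eq_zero] at this
  | rel R ts =>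
    choose z hz h1 h2 using fun k => hterm he hxs (ts k)
    simp only [BoundedFormula.Realize, h1, h2]
    exact relMap_iff hM hN hG hu hu1 hu2 R hz
  | imp φ ψ ih1 ih2 => exact imp_congr (ih1 hG hc hu he hxs) (ih2 hG hc hu he hxs)
  | all φ ih =>
    have key : ∀ {H : Subring (M × N)}, G ≤ H → Corr v w H → Countable H → ∀ {x y}, (x, y) ∈ H →
        (φ.Realize (Prod.fst ∘ e) (Fin.snoc (Prod.fst ∘ xs) x) ↔
          φ.Realize (Prod.snd ∘ e) (Fin.snoc (Prod.snd ∘ xs) y)) := by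
      intro H hle hH hHc x y hxy
      have := ih (xs := Fin.snoc xs (x, y)) hH hHc (hle hu) (fun a => hle (he a)) (fun k => by
        refine Fin.lastCases ?_ (fun k => ?_) k
        · simpa using hxy
        · simpa using hle (hxs k))
      rwa [Fin.comp_snoc, Fin.comp_snoc] at this
    simp only [BoundedFormula.Realize]
    constructor
    · intro h y
      obtain ⟨H, hle, hHc, hH, x, hx⟩ := exists_extension_symm hM hN hv hG hc hu hu1 hu2 y
      exact (key hle hH hHc hx).1 (h x)
    · intro h x
      obtain ⟨H, hle, hHc, hH, y, hy⟩ := exists_extension hM hN hw hG hc hu hu1 hu2 x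
      exact (key hle hH hHc hy).2 (h y)

end BackAndForth

section Ultrapower

open FirstOrder.Language Filter

variable {K : Type*} [Field K] {Γ : Type*} [LinearOrderedCommGroupWithZero Γ]

/-- The ultrapower of `K` along a nonprincipal ultrafilter on `ℕ`. -/
abbrev Ultrapower (K : Type*) : Type _ := Germ (hyperfilter ℕ : Filter ℕ) K

/-- The elements of the ultrapower that are integral almost everywhere. -/
def ultrapowerIntegers (v : Valuation K Γ) : Set (Ultrapower K) :=
  {x | x.LiftPred fun a => v a ≤ 1}

theorem coe_mem_ultrapowerIntegers (v : Valuation K Γ) (f : ℕ → K) :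
    (f : Ultrapower K) ∈ ultrapowerIntegers v ↔ ∀ᶠ n in hyperfilter ℕ, v (f n) ≤ 1 :=
  Germ.liftPred_coe (p := fun a => v a ≤ 1)

/-- The valuation ring of the ultrapower. -/
def ultrapowerRing (v : Valuation K Γ) : ValuationSubring (Ultrapower K) where
  carrier := ultrapowerIntegers v
  zero_mem' := (coe_mem_ultrapowerIntegers v 0).2 (by simp)
  one_mem' := (coe_mem_ultrapowerIntegers v 1).2 (by simp)
  add_mem' {a b} := Germ.inductionOn₂ a b fun f g hf hg =>
    (coe_mem_ultrapowerIntegers v (f + g)).2 <|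
      (((coe_mem_ultrapowerIntegers v f).1 hf).and ((coe_mem_ultrapowerIntegers v g).1 hg)).mono
        fun _ h => v.map_add_le h.1 h.2
  mul_mem' {a b} := Germ.inductionOn₂ a b fun f g hf hg =>
    (coe_mem_ultrapowerIntegers v (f * g)).2 <|
      (((coe_mem_ultrapowerIntegers v f).1 hf).and ((coe_mem_ultrapowerIntegers v g).1 hg)).mono
        fun _ h => (map_mul v _ _).trans_le (mul_le_one' h.1 h.2)
  neg_mem' {a} := Germ.inductionOn a fun f hf =>
    (coe_mem_ultrapowerIntegers v (-f)).2 <| ((coe_mem_ultrapowerIntegers v f).1 hf).mono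
      fun _ h => (v.map_neg _).trans_le h
  mem_or_inv_mem' a := Germ.inductionOn a fun f =>
    (Ultrafilter.eventually_or.1 (Eventually.of_forall fun n =>
      v.val_le_one_or_val_inv_le_one (f n))).imp
        (coe_mem_ultrapowerIntegers v f).2 (coe_mem_ultrapowerIntegers v f⁻¹).2

/-- The ultrapower of a valuation. -/
noncomputable def ultrapowerValuation (v : Valuation K Γ) :
    Valuation (Ultrapower K) (ultrapowerRing v).ValueGroup :=
  (ultrapowerRing v).valuation

theorem ultrapowerValuation_le_iff (v : Valuation K Γ) (f g : ℕ → K) :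
    ultrapowerValuation v (f : Ultrapower K) ≤ ultrapowerValuation v (g : Ultrapower K) ↔
      ∀ᶠ n in hyperfilter ℕ, v (f n) ≤ v (g n) := by
  by_cases hg : ∀ᶠ n in hyperfilter ℕ, g n = 0
  · have : (g : Ultrapower K) = 0 := Germ.coe_eq.2 hg
    rw [this, map_zero, le_zero_iff, map_eq_zero]
    refine (Germ.coe_eq.trans ?_ : (f : Ultrapower K) = ((0 : ℕ → K) : Ultrapower K) ↔ _)
    refine eventually_congr (hg.mono fun n hn => ?_)
    simp [hn]
  · have hg' := Ultrafilter.eventually_not.2 hg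
    have h0 : (g : Ultrapower K) ≠ 0 := fun h => hg (Germ.coe_eq.1 h)
    have h1 : 0 < ultrapowerValuation v (g : Ultrapower K) :=
      zero_lt_iff.2 ((_root_.map_ne_zero _).2 h0)
    rw [← div_le_one₀ h1, ← map_div₀]
    refine ((ultrapowerRing v).valuation_le_one_iff _).trans
      ((coe_mem_ultrapowerIntegers v (f / g)).trans ?_)
    refine eventually_congr (hg'.mono fun n hn => ?_)
    rw [Pi.div_apply, map_div₀, div_le_one₀ (zero_lt_iff.2 ((_root_.map_ne_zero v).2 hn))]

theorem ultrapowerValuation_eq_iff (v : Valuation K Γ) (f g : ℕ → K) :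
    ultrapowerValuation v (f : Ultrapower K) = ultrapowerValuation v (g : Ultrapower K) ↔
      ∀ᶠ n in hyperfilter ℕ, v (f n) = v (g n) := by
  simp only [le_antisymm_iff, ultrapowerValuation_le_iff, eventually_and]

theorem eventually_exists_iff {ι : Type*} {l : Filter ι} {K : Type*} {p : ι → K → Prop}
    [Nonempty K] :
    (∀ᶠ n in l, ∃ y, p n y) ↔ ∃ y : ι → K, ∀ᶠ n in l, p n (y n) := by
  classical
  refine ⟨fun h => ⟨fun n => Classical.epsilon (p n), h.mono fun n hn => Classical.epsilon_spec hn⟩,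
    fun ⟨y, hy⟩ => hy.mono fun n hn => ⟨_, hn⟩⟩

omit [Field K] in
theorem exists_germ_iff {p : Ultrapower K → Prop} : (∃ y, p y) ↔ ∃ y : ℕ → K, p y :=
  ⟨fun ⟨y, hy⟩ => by induction y using Germ.inductionOn with | _ f => exact ⟨f, hy⟩,
    fun ⟨y, hy⟩ => ⟨y, hy⟩⟩

theorem ultrapower_structure_eq (v : Valuation K Γ) (u : K) :
    valuedStructure (ultrapowerValuation v) (ultrapowerValuation v ((fun _ => u : ℕ → K) :
      Ultrapower K)) =
    @Ultraproduct.structure ℕ (fun _ => K) (hyperfilter ℕ) LVR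
      (fun _ => valuedStructure v (v u)) := by
  let _ := valuedStructure v (v u)
  ext n s x
  · choose f hf using fun i => Germ.inductionOn (x i) (p := fun y => ∃ f : ℕ → K, (f : Ultrapower K) = y)
      fun f => ⟨f, rfl⟩
    obtain rfl : (fun i => (f i : Ultrapower K)) = x := funext hf
    refine Eq.trans ?_ (Ultraproduct.funMap_cast (L := LVR) (M := fun _ => K)
      (u := hyperfilter ℕ) s f).symm
    cases s <;> rfl
  · choose f hf using fun i => Germ.inductionOn (x i) (p := fun y => ∃ f : ℕ → K, (f : Ultrapower K) = y)
      fun f => ⟨f, rfl⟩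
    obtain rfl : (fun i => (f i : Ultrapower K)) = x := funext hf
    refine Iff.trans ?_ (relMap_quotient_mk' (L := LVR)
      (s := (hyperfilter ℕ : Filter ℕ).productSetoid fun _ => K) s f).symm
    cases s with
    | dvd => exact ultrapowerValuation_le_iff v _ _
    | N => exact ultrapowerValuation_eq_iff v _ _
    | pow m =>
      refine Iff.trans ?_ eventually_exists_iff.symm
      exact exists_germ_iff.trans (exists_congr fun y => Germ.coe_eq (g := y ^ (m : ℕ)))

theorem isSaturated_ultrapowerValuation (v : Valuation K Γ) :
    IsSaturated (ultrapowerValuation v) := by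
  intro S hS hfin
  have hint : ∀ k, ∃ T : ℕ → Set K, ∀ f : ℕ → K, (f : Ultrapower K) ∈ S k ↔
      ∀ᶠ n in hyperfilter ℕ, f n ∈ T n := by
    intro k
    have hs := hS k
    generalize S k = s at hs
    cases hs with
    | le a b =>
      induction a using Germ.inductionOn with | _ a
      induction b using Germ.inductionOn with | _ b
      exact ⟨fun n => {y | v (y - a n) ≤ v (b n)}, fun f => ultrapowerValuation_le_iff v (f - a) b⟩
    | ge a b =>
      induction a using Germ.inductionOn with | _ a
      induction b using Germ.inductionOn with | _ b
      exact ⟨fun n => {y | v (b n) ≤ v (y - a n)}, fun f => ultrapowerValuation_le_iff v b (f - a)⟩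
    | pow l a =>
      induction a using Germ.inductionOn with | _ a
      refine ⟨fun n => {y | IsValPow v l (y * a n)}, fun f => Iff.trans ?_ eventually_exists_iff.symm⟩
      refine exists_germ_iff.trans (exists_congr fun y => ?_)
      rw [← map_pow]
      refine (ultrapowerValuation_eq_iff v (f * a) (y ^ l)).trans (eventually_congr <| .of_forall fun n => ?_)
      simp
  choose T hT using hint
  have hex : ∀ m, ∀ᶠ n in hyperfilter ℕ, ∃ y, ∀ k < m, y ∈ T k n := fun m => by
    obtain ⟨y, hy⟩ := hfin m
    induction y using Germ.inductionOn with | _ f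
    refine eventually_exists_iff.2 ⟨f, ?_⟩
    exact ((Set.finite_lt_nat m).eventually_all).2 fun k hk => (hT k f).1 (hy k hk)
  classical
  let r : ℕ → ℕ := fun n => Nat.findGreatest (fun m => ∃ y, ∀ k < m, y ∈ T k n) n
  have hr : ∀ n, ∃ y, ∀ k < r n, y ∈ T k n := fun n =>
    Nat.findGreatest_spec (P := fun m => ∃ y, ∀ k < m, y ∈ T k n) (Nat.zero_le n) ⟨0, by simp⟩
  choose f hf using hr
  refine ⟨(f : Ultrapower K), fun k => (hT k f).2 ?_⟩
  have hge : ∀ᶠ n in hyperfilter ℕ, k + 1 ≤ n :=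
    (Nat.hyperfilter_le_atTop (eventually_ge_atTop (k + 1)))
  filter_upwards [hex (k + 1), hge] with n h1 h2
  exact hf n k (Nat.le_findGreatest h2 h1)

theorem ultrapower_realize_iff (v : Valuation K Γ) (u : K) {α : Type*} (φ : LVR.Formula α)
    (x : α → K) :
    @Formula.Realize LVR K (valuedStructure v (v u)) α φ x ↔
    @Formula.Realize LVR (Ultrapower K) (valuedStructure (ultrapowerValuation v)
      (ultrapowerValuation v ((fun _ => u : ℕ → K) : Ultrapower K))) α φ
      fun a => ((fun _ => x a : ℕ → K) : Ultrapower K) := by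
  rw [ultrapower_structure_eq]
  let _ := valuedStructure v (v u)
  refine Iff.trans ?_ (Ultraproduct.realize_formula_cast (M := fun _ => K) (u := hyperfilter ℕ)
    φ fun a _ => x a).symm
  simp

end Ultrapower

section Sentences

open FirstOrder.Language FirstOrder.Language.Term

variable {α : Type*}

/-- The formula `v s ≤ v t`. -/
def leFormula (s t : LVR.Term α) : LVR.Formula α :=
  Relations.formula₂ (L := LVR) LVRRel.dvd t s

/-- The formula `v s = γ`. -/
def leastFormula (s : LVR.Term α) : LVR.Formula α :=
  Relations.formula₁ (L := LVR) LVRRel.N s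

/-- The term `0`. -/
def zeroTerm : LVR.Term α := func (L := LVR) LVRFunc.zero ![]

/-- The term `1`. -/
def oneTerm : LVR.Term α := func (L := LVR) LVRFunc.one ![]

/-- The term `s + t`. -/
def addTerm (s t : LVR.Term α) : LVR.Term α := Functions.apply₂ (L := LVR) LVRFunc.add s t

/-- The term `s * t`. -/
def mulTerm (s t : LVR.Term α) : LVR.Term α := Functions.apply₂ (L := LVR) LVRFunc.mul s t

/-- The term `n`. -/
def natTerm : ℕ → LVR.Term α
  | 0 => zeroTerm
  | n + 1 => addTerm (natTerm n) oneTerm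

/-- The term `tⁿ`. -/
def powTerm (t : LVR.Term α) : ℕ → LVR.Term α
  | 0 => oneTerm
  | n + 1 => mulTerm (powTerm t n) t

/-- The term `∑ k, c k * t ^ (k + m)`. -/
def sumTerm (t : LVR.Term α) (m : ℕ) : ∀ {d : ℕ}, (Fin d → LVR.Term α) → LVR.Term α
  | 0, _ => zeroTerm
  | d + 1, c => addTerm (sumTerm t m fun k : Fin d => c k.castSucc)
      (mulTerm (c (Fin.last d)) (powTerm t (d + m)))

section Realize

variable {K : Type*} [Field K] {Γ : Type*} [LinearOrderedCommGroupWithZero Γ] (v : Valuation K Γ)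
  (γ : Γ) (x : α → K)

theorem realize_leFormula (s t : LVR.Term α) :
    letI := valuedStructure v γ
    (leFormula s t).Realize x ↔ v (s.realize x) ≤ v (t.realize x) := by
  let _ := valuedStructure v γ
  exact Formula.realize_rel₂

theorem realize_leastFormula (s : LVR.Term α) :
    letI := valuedStructure v γ
    (leastFormula s).Realize x ↔ v (s.realize x) = γ := by
  let _ := valuedStructure v γ
  exact Formula.realize_rel₁

theorem realize_zeroTerm :
    letI := valuedStructure v γ
    (zeroTerm : LVR.Term α).realize x = 0 := rfl

theorem realize_oneTerm :
    letI := valuedStructure v γ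
    (oneTerm : LVR.Term α).realize x = 1 := rfl

theorem realize_addTerm (s t : LVR.Term α) :
    letI := valuedStructure v γ
    (addTerm s t).realize x = s.realize x + t.realize x := rfl

theorem realize_mulTerm (s t : LVR.Term α) :
    letI := valuedStructure v γ
    (mulTerm s t).realize x = s.realize x * t.realize x := rfl

theorem realize_natTerm (n : ℕ) :
    letI := valuedStructure v γ
    (natTerm n : LVR.Term α).realize x = n := by
  induction n with
  | zero => exact Nat.cast_zero.symm
  | succ n ih => rw [natTerm, realize_addTerm, ih, realize_oneTerm, Nat.cast_succ]

theorem realize_powTerm (t : LVR.Term α) (n : ℕ) :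
    letI := valuedStructure v γ
    (powTerm t n).realize x = t.realize x ^ n := by
  induction n with
  | zero => exact (pow_zero _).symm
  | succ n ih => rw [powTerm, realize_mulTerm, ih, pow_succ]

theorem realize_sumTerm (t : LVR.Term α) (m : ℕ) {d : ℕ} (c : Fin d → LVR.Term α) :
    letI := valuedStructure v γ
    (sumTerm t m c).realize x = ∑ k : Fin d, (c k).realize x * t.realize x ^ (k + m : ℕ) := by
  induction d with
  | zero => rfl
  | succ d ih =>
    rw [sumTerm, realize_addTerm, ih, realize_mulTerm, realize_powTerm, Fin.sum_univ_castSucc]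
    rfl

end Realize

/-- Residue characteristic not dividing `n`. -/
def natCastSentence (n : ℕ) : LVR.Sentence := leFormula oneTerm (natTerm n)

/-- Every polynomial in Hensel form of degree `< d + 2` has an integral root. -/
noncomputable def henselSentence (d : ℕ) : LVR.Sentence :=
  Formula.iAlls (Fin (d + 1)) <|
    (leFormula (var (Sum.inr 0)) oneTerm ⊓
      Formula.iInf fun k : Fin d => ∼(leFormula oneTerm (var (Sum.inr k.succ)))).imp <|
    Formula.iExs Unit <| leFormula (var (Sum.inr ())) oneTerm ⊓
      (addTerm (addTerm (var (Sum.inr ())) (var (Sum.inl (Sum.inr 0))))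
        (sumTerm (var (Sum.inr ())) 2 fun k : Fin d => var (Sum.inl (Sum.inr k.succ)))).equal
        zeroTerm

/-- Every monic integral polynomial of degree `d` has a root in the residue field. -/
noncomputable def residueSentence (d : ℕ) : LVR.Sentence :=
  Formula.iAlls (Fin d) <|
    (Formula.iInf fun k : Fin d => leFormula (var (Sum.inr k)) oneTerm).imp <|
    Formula.iExs Unit <| leFormula (var (Sum.inr ())) oneTerm ⊓
      ∼(leFormula oneTerm (addTerm (powTerm (var (Sum.inr ())) d)
        (sumTerm (var (Sum.inr ())) 0 fun k : Fin d => var (Sum.inl (Sum.inr k)))))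

/-- `γ` is the least positive element of the value group. -/
noncomputable def leastSentence : LVR.Sentence :=
  Formula.iAlls (Fin 2) <| (leastFormula (var (Sum.inr 0))).imp <|
    ∼(leFormula (var (Sum.inr 0)) zeroTerm) ⊓ ∼(leFormula oneTerm (var (Sum.inr 0))) ⊓
      (leFormula oneTerm (var (Sum.inr 1)) ⊔ leFormula (var (Sum.inr 1)) (var (Sum.inr 0)))

/-- Every element of the value group is divisible by `n` up to a multiple of `γ`. -/
noncomputable def powSentence (n : ℕ) : LVR.Sentence :=
  Formula.iAlls (Fin 2) <| (leastFormula (var (Sum.inr 0))).imp <|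
    (leFormula (var (Sum.inr 1)) zeroTerm) ⊔ Formula.iSup fun i : Fin n => Formula.iExs Unit <|
      leFormula (var (Sum.inl (Sum.inr 1)))
        (mulTerm (powTerm (var (Sum.inl (Sum.inr 0))) i) (powTerm (var (Sum.inr ())) n)) ⊓
      leFormula (mulTerm (powTerm (var (Sum.inl (Sum.inr 0))) i) (powTerm (var (Sum.inr ())) n))
        (var (Sum.inl (Sum.inr 1)))

/-- The sentences expressing `IsModel`. -/
inductive IsModelSentence : LVR.Sentence → Prop
  | map_natCast (n : ℕ) (hn : n ≠ 0) : IsModelSentence (natCastSentence n)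
  | hensel (d : ℕ) : IsModelSentence (henselSentence d)
  | residue (d : ℕ) (hd : d ≠ 0) : IsModelSentence (residueSentence d)
  | least : IsModelSentence leastSentence
  | exists_pow (n : ℕ) (hn : n ≠ 0) : IsModelSentence (powSentence n)

variable {K : Type*} [Field K] {Γ : Type*} [LinearOrderedCommGroupWithZero Γ] {v : Valuation K Γ}
  {γ : Γ}

theorem realize_natCastSentence {n : ℕ} :
    @Sentence.Realize LVR K (valuedStructure v γ) (natCastSentence n) ↔ 1 ≤ v (n : K) := by
  let _ := valuedStructure v γ
  simp only [Sentence.Realize, natCastSentence, realize_leFormula, realize_oneTerm,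
    realize_natTerm, map_one]

theorem realize_henselSentence {d : ℕ} :
    @Sentence.Realize LVR K (valuedStructure v γ) (henselSentence d) ↔
      ∀ c : Fin (d + 1) → K, (v (c 0) ≤ 1 ∧ ∀ k : Fin d, v (c k.succ) < 1) →
        ∃ z, v z ≤ 1 ∧ z + c 0 + ∑ k : Fin d, c k.succ * z ^ (k + 2 : ℕ) = 0 := by
  let _ := valuedStructure v γ
  simp only [Sentence.Realize, henselSentence, Formula.realize_iAlls, Formula.realize_imp,
    Formula.realize_inf, realize_leFormula, Formula.realize_iInf, Formula.realize_not,
    Formula.realize_iExs, Formula.realize_equal, realize_addTerm, realize_sumTerm,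
    realize_zeroTerm, realize_oneTerm, Term.realize_var, Sum.elim_inr, Sum.elim_inl, map_one,
    not_le]
  exact forall₂_congr fun c _ => ⟨fun ⟨z, hz⟩ => ⟨z (), hz⟩, fun ⟨z, hz⟩ => ⟨fun _ => z, hz⟩⟩

theorem realize_residueSentence {d : ℕ} :
    @Sentence.Realize LVR K (valuedStructure v γ) (residueSentence d) ↔
      ∀ c : Fin d → K, (∀ k, v (c k) ≤ 1) →
        ∃ z, v z ≤ 1 ∧ v (z ^ d + ∑ k : Fin d, c k * z ^ (k : ℕ)) < 1 := by
  let _ := valuedStructure v γ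
  simp only [Sentence.Realize, residueSentence, Formula.realize_iAlls, Formula.realize_imp,
    Formula.realize_inf, realize_leFormula, Formula.realize_iInf, Formula.realize_not,
    Formula.realize_iExs, realize_powTerm, realize_addTerm, realize_sumTerm, realize_oneTerm,
    Term.realize_var, Sum.elim_inr, Sum.elim_inl, map_one, not_le, add_zero]
  exact forall₂_congr fun c _ => ⟨fun ⟨z, hz⟩ => ⟨z (), hz⟩, fun ⟨z, hz⟩ => ⟨fun _ => z, hz⟩⟩

theorem realize_leastSentence :
    @Sentence.Realize LVR K (valuedStructure v γ) leastSentence ↔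
      ∀ c : Fin 2 → K, v (c 0) = γ →
        (c 0 ≠ 0 ∧ v (c 0) < 1) ∧ (1 ≤ v (c 1) ∨ v (c 1) ≤ v (c 0)) := by
  let _ := valuedStructure v γ
  simp only [Sentence.Realize, leastSentence, Formula.realize_iAlls, Formula.realize_imp,
    Formula.realize_inf, realize_leFormula, realize_leastFormula, Formula.realize_not,
    Formula.realize_sup, realize_zeroTerm, realize_oneTerm, Term.realize_var, Sum.elim_inr,
    map_one, map_zero, not_le, zero_lt_iff, v.ne_zero_iff]

theorem realize_powSentence {n : ℕ} :
    @Sentence.Realize LVR K (valuedStructure v γ) (powSentence n) ↔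
      ∀ c : Fin 2 → K, v (c 0) = γ →
        c 1 = 0 ∨ ∃ i : Fin n, ∃ y, v (c 1) = v (c 0) ^ (i : ℕ) * v y ^ n := by
  let _ := valuedStructure v γ
  simp only [Sentence.Realize, powSentence, Formula.realize_iAlls, Formula.realize_imp,
    Formula.realize_inf, realize_leFormula, realize_leastFormula, Formula.realize_iExs,
    Formula.realize_iSup, Formula.realize_sup, realize_mulTerm, realize_powTerm, realize_zeroTerm,
    Term.realize_var, Sum.elim_inr, Sum.elim_inl, map_zero, le_zero_iff, map_eq_zero, map_mul,
    map_pow, ← le_antisymm_iff]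
  exact forall₂_congr fun c _ => or_congr_right <| exists_congr fun i =>
    ⟨fun ⟨z, hz⟩ => ⟨z (), hz⟩, fun ⟨z, hz⟩ => ⟨fun _ => z, hz⟩⟩

theorem IsModel.realize (hM : IsModel v γ) {φ : LVR.Sentence} (hφ : IsModelSentence φ) :
    @Sentence.Realize LVR K (valuedStructure v γ) φ := by
  cases hφ with
  | map_natCast n hn => exact realize_natCastSentence.2 (hM.map_natCast n hn).ge
  | hensel d =>
    refine realize_henselSentence.2 fun c hc => ?_
    obtain ⟨z, hz, h⟩ := hM.hensel (X + C (c 0) + ∑ k : Fin d, C (c k.succ) * X ^ (k + 2 : ℕ))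
      ⟨by simpa [coeff_X_zero, finsetSum_coeff, coeff_X_pow] using hc.1,
       by simp [coeff_X_pow], fun j hj => by
        have h1 : j ≠ 1 := by omega
        have h0 : j ≠ 0 := by omega
        simp only [coeff_add, coeff_X, h1.symm, if_false, coeff_C, h0, zero_add, finsetSum_coeff,
          coeff_C_mul_X_pow]
        refine v.map_sum_lt one_ne_zero fun k _ => ?_
        split_ifs
        · exact hc.2 k
        · simp⟩
    exact ⟨z, hz, by simpa [eval_finsetSum] using h⟩
  | residue d hd =>
    refine realize_residueSentence.2 fun c hc => ?_
    have hdeg : (∑ k : Fin d, C (c k) * X ^ (k : ℕ)).degree < (d : WithBot ℕ) :=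
      degree_sum_fin_lt c
    have hnat : (X ^ d + ∑ k : Fin d, C (c k) * X ^ (k : ℕ)).natDegree = d :=
      natDegree_eq_of_degree_eq_some
        ((degree_add_eq_left_of_degree_lt (by rwa [degree_X_pow])).trans (degree_X_pow d))
    obtain ⟨z, hz, h⟩ := hM.residue (d + 1) (X ^ d + ∑ k : Fin d, C (c k) * X ^ (k : ℕ))
      (monic_X_pow_add hdeg) (by rwa [hnat])
      (by rw [hnat]; omega) fun j => by
        simp only [coeff_add, coeff_X_pow, finsetSum_coeff, coeff_C_mul_X_pow]
        refine v.map_add_le (by split_ifs <;> simp) (v.map_sum_le fun k _ => ?_)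
        split_ifs
        · exact hc k
        · simp
    exact ⟨z, hz, by simpa [eval_finsetSum] using h⟩
  | least =>
    refine realize_leastSentence.2 fun c hc =>
      ⟨⟨fun h => hM.ne_zero (by rw [← hc, h, map_zero]), hc ▸ hM.lt_one⟩, ?_⟩
    rw [hc, or_iff_not_imp_left, not_le]
    exact hM.le_of_lt_one _
  | exists_pow n hn =>
    refine realize_powSentence.2 fun c hc => or_iff_not_imp_left.2 fun h0 => ?_
    obtain ⟨i, hi, y, hy⟩ := hM.exists_pow n hn _ h0
    exact ⟨⟨i, hi⟩, y, by rwa [hc]⟩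

theorem IsModel.of_realize {u : K} (hu : v u = γ)
    (h : ∀ φ, IsModelSentence φ → @Sentence.Realize LVR K (valuedStructure v γ) φ) :
    IsModel v γ where
  map_natCast n hn :=
    (map_natCast_le_one v n).antisymm (realize_natCastSentence.1 (h _ (.map_natCast n hn)))
  hensel p hp := by
    obtain ⟨z, hz, h⟩ := realize_henselSentence.1 (h _ (.hensel p.natDegree))
      (Fin.cons (p.coeff 0) fun k => p.coeff (k + 2)) ⟨hp.coeff_zero, fun k => by
        simpa using hp.coeff_lt _ (by omega)⟩
    refine ⟨z, hz, ?_⟩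
    rw [eval_eq_sum_range' (n := p.natDegree + 2) (by omega), Finset.sum_range_succ',
      Finset.sum_range_succ', ← Fin.sum_univ_eq_sum_range (fun k => p.coeff (k + 1 + 1) * z ^ (k + 1 + 1))]
    simp only [Fin.cons_zero, Fin.cons_succ] at h
    simpa [hp.coeff_one, add_comm, add_left_comm, add_assoc] using h
  residue n p hp hd _ hc := by
    obtain ⟨z, hz, h⟩ := realize_residueSentence.1 (h _ (.residue p.natDegree hd))
      (fun k => p.coeff k) fun k => hc k
    refine ⟨z, hz, ?_⟩
    rw [eval_eq_sum_range, Finset.sum_range_succ, hp.coeff_natDegree, one_mul, add_comm,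
      ← Fin.sum_univ_eq_sum_range (fun k => p.coeff k * z ^ k)]
    exact h
  ne_zero := hu ▸ v.ne_zero_iff.2
    (realize_leastSentence.1 (h _ .least) (fun _ => u) hu).1.1
  lt_one := hu ▸ (realize_leastSentence.1 (h _ .least) (fun _ => u) hu).1.2
  le_of_lt_one x hx := hu ▸
    (realize_leastSentence.1 (h _ .least) ![u, x] hu).2.resolve_left (not_le.2 hx)
  exists_pow n hn x hx := by
    obtain ⟨i, y, hy⟩ := (realize_powSentence.1 (h _ (.exists_pow n hn)) ![u, x] hu).resolve_left hx
    exact ⟨i, i.2, y, hu ▸ hy⟩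

theorem IsModel.ultrapower {u : K} (hM : IsModel v (v u)) :
    IsModel (ultrapowerValuation v)
      (ultrapowerValuation v ((fun _ => u : ℕ → K) : Ultrapower K)) :=
  .of_realize rfl fun φ hφ => by
    rw [Sentence.Realize, Subsingleton.elim (default : Empty → Ultrapower K)]
    exact (ultrapower_realize_iff v u φ default).1 (hM.realize hφ)

theorem IsModel.of_elementarilyEquivalent {L Δ : Type*} [Field L]
    [LinearOrderedCommGroupWithZero Δ] {w : Valuation L Δ} {δ : Δ} (hN : IsModel w δ) {u : K}
    (hu : v u = γ)
    (h : @ElementarilyEquivalent LVR K L (valuedStructure v γ) (valuedStructure w δ)) :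
    IsModel v γ := by
  let _ := valuedStructure v γ
  let _ := valuedStructure w δ
  exact .of_realize hu fun φ hφ => (elementarilyEquivalent_iff.1 h φ).2 (hN.realize hφ)

end Sentences

section Laurent

open WithZero LaurentSeries

theorem le_exp_of_lt_exp {x : WithZero (Multiplicative ℤ)} {n : ℤ} (h : x < exp n) :
    x ≤ exp (n - 1) := by
  induction x using WithZero.expRecOn with
  | zero => exact zero_le
  | exp m => rw [exp_lt_exp] at h; rw [exp_le_exp]; omega

variable {F : Type*} [Field F]

theorem laurent_map_coe_le_one (f : PowerSeries F) : Valued.v (f : F⸨X⸩) ≤ (1 : WithZero (Multiplicative ℤ)) :=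
  (val_le_one_iff_eq_coe F _).2 ⟨f, rfl⟩

theorem laurent_map_coe_lt_one {f : PowerSeries F} (hf : PowerSeries.constantCoeff f = 0) :
    Valued.v (f : F⸨X⸩) < (1 : WithZero (Multiplicative ℤ)) := by
  refine lt_of_le_of_lt ((valuation_le_iff_coeff_lt_eq_zero F (D := 1)).2 fun n hn => ?_)
    (by rw [← exp_zero, exp_lt_exp]; omega)
  rw [PowerSeries.coeff_coe]
  split_ifs with h
  · rfl
  · obtain rfl : n = 0 := by omega
    simpa using hf

/-- A sequence of integral Laurent series with consecutive differences tending to zero linearly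
has a limit. -/
theorem laurent_exists_limit {z : ℕ → F⸨X⸩} (hz : ∀ n, Valued.v (z n) ≤ (1 : WithZero (Multiplicative ℤ)))
    (h : ∀ n : ℕ, Valued.v (z (n + 1) - z n) ≤ exp (-n : ℤ)) :
    ∃ l : F⸨X⸩, Valued.v l ≤ (1 : WithZero (Multiplicative ℤ)) ∧
      ∀ n : ℕ, Valued.v (l - z n) ≤ exp (-n : ℤ) := by
  have hstab : ∀ (k m n : ℕ), k < n → (z (n + m)).coeff k = (z n).coeff k := by
    intro k m n hkn
    induction m with
    | zero => rfl
    | succ m ih =>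
      rw [← ih]
      exact eq_coeff_of_valuation_sub_lt F (h (n + m)) (by omega)
  refine ⟨(PowerSeries.mk fun n => (z (n + 1)).coeff n : PowerSeries F), laurent_map_coe_le_one _,
    fun n => (valuation_le_iff_coeff_lt_eq_zero F).2 fun k hk => ?_⟩
  rw [HahnSeries.coeff_sub, PowerSeries.coeff_coe, sub_eq_zero]
  split_ifs with h0
  · rw [← exp_zero, ← neg_zero] at hz
    exact ((valuation_le_iff_coeff_lt_eq_zero F).1 (hz n) k h0).symm
  · lift k to ℕ using not_lt.1 h0
    rw [PowerSeries.coeff_mk, Int.natAbs_natCast]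
    obtain ⟨m, rfl⟩ := Nat.exists_eq_add_of_lt (Nat.cast_lt.1 hk)
    rw [show k + m + 1 = k + 1 + m by ring, hstab k m (k + 1) k.lt_succ_self]

theorem laurent_hensel {p : F⸨X⸩[X]} (hp : HenselForm (Valued.v (R := F⸨X⸩)) p) :
    ∃ z, Valued.v z ≤ (1 : WithZero (Multiplicative ℤ)) ∧ p.eval z = 0 := by
  set v : Valuation F⸨X⸩ (WithZero (Multiplicative ℤ)) := Valued.v
  let q := p - X
  have hq : ∀ k, v ((q - C (p.coeff 0)).coeff k) < 1 := fun k => by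
    match k with
    | 0 => simp [q]
    | 1 => simp [q, hp.coeff_one]
    | k + 2 =>
      have := hp.coeff_lt (k + 2) (by omega)
      simpa [q, coeff_sub, coeff_X, coeff_C] using this
  have hq1 : ∀ k, v (q.coeff k) ≤ 1 := fun k => by
    have : q.coeff k = (q - C (p.coeff 0)).coeff k + (C (p.coeff 0)).coeff k := by simp
    rw [this]
    refine v.map_add_le (hq k).le ?_
    rw [coeff_C]
    split_ifs
    · exact hp.coeff_zero
    · simp
  have hcontr : ∀ x y, v x ≤ 1 → v y ≤ 1 → ∀ n : ℤ, v (x - y) ≤ exp n →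
      v (q.eval x - q.eval y) ≤ exp (n - 1) := by
    intro x y hx hy n hxy
    by_cases h : x = y
    · simp [h]
    · have := map_eval_sub_eval_lt v hq hx hy h
      simp only [eval_sub, eval_C, sub_sub_sub_cancel_right] at this
      exact le_exp_of_lt_exp (this.trans_le hxy)
  let z : ℕ → F⸨X⸩ := fun n => (fun x => -q.eval x)^[n] 0
  have hs : ∀ n, z (n + 1) = -q.eval (z n) := fun n => Function.iterate_succ_apply' _ _ _
  have hz : ∀ n, v (z n) ≤ 1 := by
    intro n
    induction n with
    | zero => simp [z]
    | succ n ih => rw [hs, v.map_neg]; exact map_eval_le_one v hq1 ih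
  have hd : ∀ n : ℕ, v (z (n + 1) - z n) ≤ exp (-n : ℤ) := by
    intro n
    induction n with
    | zero => simpa [z] using hz 1
    | succ n ih =>
      rw [hs, hs n, ← neg_sub', v.map_neg]
      have := hcontr _ _ (hz (n + 1)) (hz n) _ ih
      rwa [hs n, show (-n - 1 : ℤ) = -((n + 1 : ℕ) : ℤ) by push_cast; ring] at this
  obtain ⟨l, hl, h⟩ := laurent_exists_limit hz hd
  refine ⟨l, hl, ?_⟩
  have key : ∀ n : ℕ, v (p.eval l) ≤ exp (-n : ℤ) := fun n => by
    have : p.eval l = (l - z (n + 1)) + (q.eval l - q.eval (z n)) := by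
      rw [hs]; simp only [q, eval_sub, eval_X]; ring
    rw [this]
    refine v.map_add_le ((h (n + 1)).trans (by rw [exp_le_exp]; push_cast; omega))
      ((hcontr _ _ hl (hz n) _ (h n)).trans (by rw [exp_le_exp]; omega))
  by_contra h0
  obtain ⟨m, hm⟩ : ∃ m : ℤ, v (p.eval l) = exp m := ⟨_, (exp_log (v.ne_zero_iff.2 h0)).symm⟩
  have := key (m.natAbs + 1)
  rw [hm, exp_le_exp] at this
  omega

theorem laurent_residue [IsAlgClosed F] (n : ℕ) :
    ResiduallyClosedBelow (Valued.v (R := F⸨X⸩)) n := by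
  intro p hp hd _ hc
  have hl : p ∈ lifts (HahnSeries.ofPowerSeries ℤ F) := (lifts_iff_coeff_lifts _).2 fun k =>
    (val_le_one_iff_eq_coe F _).1 (hc k)
  obtain ⟨q, rfl, hqd, hq⟩ := lifts_and_natDegree_eq_and_monic hl hp
  obtain ⟨a, ha⟩ := IsAlgClosed.exists_root (q.map (PowerSeries.constantCoeff (R := F))) (by
    rw [hq.degree_map]
    exact fun h => hd (by rw [← hqd]; exact natDegree_eq_of_degree_eq_some h))
  refine ⟨(PowerSeries.C a : PowerSeries F), laurent_map_coe_le_one _, ?_⟩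
  rw [eval_map, eval₂_at_apply]
  refine laurent_map_coe_lt_one ?_
  rw [← eval₂_at_apply, PowerSeries.constantCoeff_C, ← eval_map]
  exact ha

theorem isModel_laurent [IsAlgClosed F] [CharZero F] :
    IsModel (Valued.v (R := F⸨X⸩)) (exp (-1 : ℤ)) where
  map_natCast n hn := by
    set v : Valuation F⸨X⸩ (WithZero (Multiplicative ℤ)) := Valued.v
    have h1 := laurent_map_coe_le_one (PowerSeries.C (n : F)⁻¹ : PowerSeries F)
    have h2 : ((PowerSeries.C (n : F)⁻¹ : PowerSeries F) : F⸨X⸩) = (n : F⸨X⸩)⁻¹ := by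
      refine eq_inv_of_mul_eq_one_left ?_
      have : (n : F⸨X⸩) = ((PowerSeries.C (n : F) : PowerSeries F) : F⸨X⸩) := by simp
      rw [this, ← map_mul, ← map_mul, inv_mul_cancel₀ (Nat.cast_ne_zero.2 hn), map_one, map_one]
    have h3 := map_natCast_le_one v n
    rw [h2, map_inv₀] at h1
    have h0 : v (n : F⸨X⸩) ≠ 0 := by
      intro h
      rw [v.zero_iff] at h
      have : CharZero F⸨X⸩ := charZero_of_injective_algebraMap (algebraMap F F⸨X⸩).injective
      exact hn (by exact_mod_cast h)
    exact h3.antisymm ((inv_le_one₀ (zero_lt_iff.2 h0)).1 h1)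
  hensel _ := laurent_hensel
  residue := laurent_residue
  ne_zero := exp_ne_zero
  lt_one := by rw [← exp_zero, exp_lt_exp]; omega
  le_of_lt_one x hx := by
    rw [← exp_zero] at hx
    exact le_exp_of_lt_exp hx
  exists_pow n hn x hx := by
    have hn' : (n : ℤ) ≠ 0 := Nat.cast_ne_zero.2 hn
    obtain ⟨m, hm⟩ : ∃ m : ℤ, Valued.v x = exp (-m) :=
      ⟨-log (Valued.v x), by rw [neg_neg, exp_log ((Valuation.ne_zero_iff _).2 hx)]⟩
    have h0 := Int.emod_nonneg m hn'
    have h1 := Int.emod_lt_of_pos m (by omega : (0 : ℤ) < n)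
    refine ⟨(m % n).toNat, by omega, HahnSeries.single (m / n) 1, ?_⟩
    rw [valuation_single_zpow, hm, ← exp_nsmul, ← exp_nsmul, ← exp_add]
    congr 1
    have := Int.emod_add_mul_ediv m n
    simp only [nsmul_eq_mul, Int.toNat_of_nonneg h0]
    linarith

end Laurent

section Subfield

variable {K : Type*} [Field K] {Γ : Type*} [LinearOrderedCommGroupWithZero Γ] {v : Valuation K Γ}
  {γ : Γ} {K₀ : Subfield K}

theorem mem_of_monic_root (hK : ∀ x : K, IsAlgebraic K₀ x → x ∈ K₀) {p : K₀[X]} (hp : p ≠ 0)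
    {x : K} (hx : eval₂ K₀.subtype x p = 0) : x ∈ K₀ :=
  hK x ⟨p, hp, hx⟩

theorem exists_pow_eq_of_mem (hK : ∀ x : K, IsAlgebraic K₀ x → x ∈ K₀) {n : ℕ} (hn : n ≠ 0)
    {x : K₀} {y : K} (h : (x : K) = y ^ n) : y ∈ K₀ :=
  mem_of_monic_root hK (X_pow_sub_C_ne_zero (Nat.pos_of_ne_zero hn) x) (by
    simp [eval₂_sub, h])

theorem IsModel.subfield (hM : IsModel v γ) (hK : ∀ x : K, IsAlgebraic K₀ x → x ∈ K₀) {u : K}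
    (hu : u ∈ K₀) (huγ : v u = γ) : IsModel (v.comap K₀.subtype) γ where
  map_natCast n hn := by simpa using hM.map_natCast n hn
  hensel p hp := by
    obtain ⟨z, hz, h⟩ := hM.hensel (p.map K₀.subtype)
      ⟨by simpa using hp.coeff_zero, by simp [hp.coeff_one], fun k hk => by
        simpa using hp.coeff_lt k hk⟩
    rw [eval_map] at h
    have hp0 : p ≠ 0 := fun h => by simpa [h] using hp.coeff_one
    refine ⟨⟨z, mem_of_monic_root hK hp0 h⟩, hz, Subtype.ext ?_⟩
    exact (eval₂_at_apply K₀.subtype _).symm.trans h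
  residue n := by
    induction n with
    | zero => exact fun p _ _ h => absurd h (Nat.not_lt_zero _)
    | succ n ih =>
      intro p hp hd hdn hc
      by_contra! hno
      have hF : ResiduallyClosedBelow (v.comap K₀.subtype) p.natDegree :=
        fun q hq hq0 hqd => ih q hq hq0 (by omega)
      obtain ⟨w, hw, hws⟩ := hM.exists_residual_root hF hp hd hc fun s hs =>
        (map_eval_le_one (v.comap K₀.subtype) hc hs).antisymm (hno s hs)
      have hwK := mem_of_monic_root hK hp.ne_zero hw
      have h1 := hws 0 (by simp)
      have := hws ⟨w, hwK⟩ (by simpa using h1.le)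
      simp at this
  ne_zero := hM.ne_zero
  lt_one := hM.lt_one
  le_of_lt_one x := hM.le_of_lt_one x
  exists_pow n hn x hx := by
    obtain ⟨i, hi, y, hy⟩ := hM.exists_pow n hn x (by simpa using hx)
    have hu0 : u ≠ 0 := v.ne_zero_iff.1 (huγ ▸ hM.ne_zero)
    have hval : IsValPow v n (x / u ^ i : K) := ⟨y, by
      rw [map_div₀, map_pow, huγ, hy, mul_div_cancel_left₀ _ (pow_ne_zero _ hM.ne_zero)]⟩
    obtain ⟨z, hz⟩ := (hM.isValPow_iff hn).1 hval
    let x' : K₀ := x / ⟨u, hu⟩ ^ i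
    refine ⟨i, hi, ⟨z, exists_pow_eq_of_mem hK hn (x := x') hz⟩, ?_⟩
    change v x = γ ^ i * v z ^ n
    rw [← map_pow, ← hz, map_div₀, map_pow, huγ, mul_div_cancel₀ _ (pow_ne_zero _ hM.ne_zero)]

end Subfield

section Elementary

open FirstOrder.Language Filter

variable {K : Type*} [Field K] {Γ : Type*} [LinearOrderedCommGroupWithZero Γ] {v : Valuation K Γ}
  {γ : Γ} {K₀ : Subfield K}

/-- The diagonal embedding into the ultrapower. -/
noncomputable def diagonal (K : Type*) [Field K] : K →+* Ultrapower K :=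
  (Germ.coeRingHom _).comp (Pi.constRingHom ℕ K)

theorem isValPow_diagonal_iff {n : ℕ} {x : K} :
    IsValPow (ultrapowerValuation v) n (diagonal K x) ↔ IsValPow v n x := by
  have h : IsValPow v n x ↔ ∀ᶠ _ in (hyperfilter ℕ : Filter ℕ), ∃ y, v x = v y ^ n := by
    rw [eventually_const]; rfl
  rw [h, eventually_exists_iff]
  refine exists_germ_iff.trans (exists_congr fun y => ?_)
  rw [← map_pow]
  exact (ultrapowerValuation_eq_iff v (fun _ => x) (y ^ n)).trans (by simp)

theorem diagonal_le_iff {x y : K} :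
    ultrapowerValuation v (diagonal K x) ≤ ultrapowerValuation v (diagonal K y) ↔ v x ≤ v y :=
  (ultrapowerValuation_le_iff v (fun _ => x) fun _ => y).trans eventually_const

theorem isValPow_subfield_iff (hM : IsModel v γ) (hK : ∀ x : K, IsAlgebraic K₀ x → x ∈ K₀)
    (hM₀ : IsModel (v.comap K₀.subtype) γ) {n : ℕ} (hn : n ≠ 0) {x : K₀} :
    IsValPow (v.comap K₀.subtype) n x ↔ IsValPow v n (x : K) := by
  rw [hM.isValPow_iff hn, hM₀.isValPow_iff hn]
  exact ⟨fun ⟨y, hy⟩ => ⟨y, congrArg Subtype.val hy⟩,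
    fun ⟨y, hy⟩ => ⟨⟨y, exists_pow_eq_of_mem hK hn hy⟩, Subtype.ext hy⟩⟩

theorem realize_subfield_iff (hM : IsModel v γ) (hK : ∀ x : K, IsAlgebraic K₀ x → x ∈ K₀) {u : K}
    (hu : u ∈ K₀) (huγ : v u = γ) {α : Type*} [Countable α] (φ : LVR.Formula α) (x : α → K₀) :
    @Formula.Realize LVR K₀ (valuedStructure (v.comap K₀.subtype) γ) α φ x ↔
      @Formula.Realize LVR K (valuedStructure v γ) α φ fun a => x a := by
  subst huγ
  have hM₀ := hM.subfield hK hu rfl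
  let u₀ : K₀ := ⟨u, hu⟩
  let F := Subfield.closure (Set.range x ∪ {u₀})
  have hF : Countable F :=
    countable_subfield_closure ((Set.countable_range x).union (Set.countable_singleton u₀))
  let δ : F →+* Ultrapower K₀ × Ultrapower K :=
    ((diagonal K₀).comp F.subtype).prod ((diagonal K).comp (K₀.subtype.comp F.subtype))
  have hxF : ∀ a, x a ∈ F := fun a => Subfield.subset_closure (Or.inl ⟨a, rfl⟩)
  have huF : u₀ ∈ F := Subfield.subset_closure (Or.inr rfl)
  have hcorr : Corr (ultrapowerValuation (v.comap K₀.subtype)) (ultrapowerValuation v) δ.range := by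
    refine ⟨?_, ?_⟩
    · rintro _ ⟨a, rfl⟩ _ ⟨b, rfl⟩
      exact (diagonal_le_iff (v := v.comap K₀.subtype)).trans
        (diagonal_le_iff (v := v) (x := ((a : K₀) : K)) (y := ((b : K₀) : K))).symm
    · rintro n hn _ ⟨a, rfl⟩
      exact (isValPow_diagonal_iff (v := v.comap K₀.subtype)).trans
        ((isValPow_subfield_iff hM hK hM₀ hn).trans (isValPow_diagonal_iff (v := v)).symm)
  have hc : Countable δ.range := Set.countable_range δ
  rw [ultrapower_realize_iff v u]
  refine (ultrapower_realize_iff (v.comap K₀.subtype) u₀ φ x).trans ?_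
  have := realize_iff (IsModel.ultrapower (u := u₀) hM₀) hM.ultrapower
    (isSaturated_ultrapowerValuation _) (isSaturated_ultrapowerValuation _) φ hcorr hc
    (u := δ ⟨u₀, huF⟩) ⟨_, rfl⟩ rfl rfl (e := fun a => δ ⟨x a, hxF a⟩) (fun a => ⟨_, rfl⟩)
    (xs := Fin.elim0) fun k => k.elim0
  rw [Subsingleton.elim (Prod.fst ∘ Fin.elim0) default,
    Subsingleton.elim (Prod.snd ∘ Fin.elim0) default] at this
  exact this

theorem exists_elementary_substructure (hM : IsModel v γ)
    (hK : ∀ x : K, IsAlgebraic K₀ x → x ∈ K₀) {u : K} (hu : u ∈ K₀) (huγ : v u = γ) :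
    letI : LVR.Structure K := valuedStructure v γ
    ∃ S : LVR.Substructure K, (S : Set K) = (K₀ : Set K) ∧ S.IsElementary := by
  let _ : LVR.Structure K := valuedStructure v γ
  obtain ⟨S, hS⟩ : ∃ S : LVR.Substructure K, (S : Set K) = (K₀ : Set K) :=
    ⟨{ carrier := K₀
       fun_mem := fun f x hx => by
        cases f with
        | zero => exact K₀.zero_mem
        | one => exact K₀.one_mem
        | add => exact K₀.add_mem (hx 0) (hx 1)
        | mul => exact K₀.mul_mem (hx 0) (hx 1) }, rfl⟩
  refine ⟨S, hS, fun n φ x => ?_⟩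
  have hmem : ∀ {s : K}, s ∈ S ↔ s ∈ K₀ := Set.ext_iff.1 hS _
  let _ : LVR.Structure K₀ := valuedStructure (v.comap K₀.subtype) γ
  let g : S ≃[LVR] K₀ :=
    { toFun := fun s => ⟨s, hmem.1 s.2⟩
      invFun := fun s => ⟨s, hmem.2 s.2⟩
      left_inv := fun _ => rfl
      right_inv := fun _ => rfl
      map_fun' := fun f x => by cases f <;> rfl
      map_rel' := fun R x => by
        cases R with
        | dvd => exact Iff.rfl
        | N => exact Iff.rfl
        | pow m =>
          exact ⟨fun ⟨y, hy⟩ => ⟨y, congrArg Subtype.val hy⟩, fun ⟨y, hy⟩ =>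
            ⟨⟨y, exists_pow_eq_of_mem (x := ⟨x 0, hmem.1 (x 0).2⟩) hK m.ne_zero hy⟩,
              Subtype.ext hy⟩⟩ }
  exact (realize_subfield_iff hM hK hu huγ φ (g ∘ x)).symm.trans
    (StrongHomClass.realize_formula g φ)

end Elementary

end LVRModel

/-- Let `K` be a valued field whose value group has a least
positive element `1_Γ` (multiplicative avatar `γ₁`), regarded as an
`L_VR`-structure, elementarily equivalent to `ℂ((t))`.  Let `K₀ ⊆ K` be a
subfield, relatively algebraically closed in `K`, containing an element `u`
with `v(u) = 1_Γ`.  Then `K₀` is an elementary `L_VR`-substructure of `K`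
(i.e. the `L_VR`-substructure of `K` with underlying set `K₀` is elementary). -/
theorem stmt_13 {K : Type*} [Field K] {Γ₀ : Type*} [LinearOrderedCommGroupWithZero Γ₀]
    (v : Valuation K Γ₀) (hsurj : Function.Surjective v)
    (γ₁ : Γ₀) (hγ₁ : IsLeastPos γ₁) :
    letI : LVR.Structure K := valuedStructure v γ₁
    letI : LVR.Structure (LaurentSeries ℂ) := laurentStructure
    ∀ (_ : K ≅[LVR] LaurentSeries ℂ)
      (K₀ : Subfield K) (_ : ∀ x : K, IsAlgebraic K₀ x → x ∈ K₀)
      (u : K) (_ : u ∈ K₀) (_ : v u = γ₁),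
      ∃ S : LVR.Substructure K, (S : Set K) = (K₀ : Set K) ∧ S.IsElementary :=
  fun h _ hK _ hu huγ => LVRModel.exists_elementary_substructure
    (.of_elementarilyEquivalent LVRModel.isModel_laurent huγ h) hK hu huγ
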